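/- arXiv:1408.4514 — 2 statements merged into one kernel-verified Lean document; each statement's English description precedes it below -/
import Mathlib

section
/- For any integers u and h with 1 ≤ h ≤ q, the number of quadruples (w, x, y, z) with w, x, y, z ∈ {u+1, ..., u+h}, gcd(wxyz, q) = 1, and wx ≡ yz (mod q), is at most h^4·q^{-1+o(1)} + h^{2+o(1)}, i.e., for every ε > 0 it is O_ε(h^4 q^{-1+ε} + h^{2+ε}). -/
open Finset in
theorem card_mul_le_of_separated (T : Finset ℤ) (d D : ℤ) (hd : 0 < d) (hD : 0 ≤ D)
    (hsep : ∀ x ∈ T, ∀ y ∈ T, x ≠ y → d ≤ |x - y|)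
    (hdiam : ∀ x ∈ T, ∀ y ∈ T, |x - y| ≤ D) : d * (#T : ℤ) ≤ D + d := by
  rcases T.eq_empty_or_nonempty with rfl | hT
  · simp; omega
  set x₀ := T.min' hT with hx₀
  have hx₀T : x₀ ∈ T := T.min'_mem hT
  have hcard : #T ≤ #(Icc 0 (D / d)) := by
    refine card_le_card_of_injOn (fun x => (x - x₀) / d) ?_ ?_
    · intro x hx
      have hmin : x₀ ≤ x := T.min'_le x hx
      have := hdiam x hx x₀ hx₀T
      simp only [coe_Icc, Set.mem_Icc]
      exact ⟨Int.ediv_nonneg (by omega) hd.le,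
        Int.ediv_le_ediv hd (by rw [abs_of_nonneg (by omega)] at this; exact this)⟩
    · intro x hx y hy hxy
      by_contra hne
      have h1 := hsep x hx y hy hne
      simp only at hxy
      have e1 := Int.mul_ediv_add_emod (x - x₀) d
      have e2 := Int.mul_ediv_add_emod (y - x₀) d
      have b1 := Int.emod_nonneg (x - x₀) hd.ne'
      have b2 := Int.emod_nonneg (y - x₀) hd.ne'
      have c1 := Int.emod_lt_of_pos (x - x₀) hd
      have c2 := Int.emod_lt_of_pos (y - x₀) hd
      rw [hxy] at e1
      rcases le_abs.mp h1 with h | h <;> omega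
  have hq : 0 ≤ D / d := Int.ediv_nonneg hD hd.le
  rw [Int.card_Icc] at hcard
  have h2 : (#T : ℤ) ≤ D / d + 1 := by omega
  nlinarith [Int.mul_ediv_self_le (x := D) (k := d) hd.ne']

open Finset in
/-- Points of a planar set lying on the lines `p.1 * b - p.2 * a ≡ 0 (mod q)`, separated in the sup
norm by the length of `(a, b)`. -/
theorem card_mul_le_of_det_dvd (S : Finset (ℤ × ℤ)) (q h a b : ℤ) (hq : 0 < q)
    (hab : 0 < max |a| |b|) (hmh : max |a| |b| ≤ h)
    (hdiam : ∀ p ∈ S, ∀ p' ∈ S, |p.1 - p'.1| ≤ h ∧ |p.2 - p'.2| ≤ h)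
    (hsep : ∀ p ∈ S, ∀ p' ∈ S, p ≠ p' → max |a| |b| ≤ max |p.1 - p'.1| |p.2 - p'.2|)
    (hdvd : ∀ p ∈ S, q ∣ p.1 * b - p.2 * a) :
    q * max |a| |b| * (#S : ℤ) ≤ 2 * h * (2 * max |a| |b| * h + q) := by
  set m := max |a| |b| with hm
  have ham : |a| ≤ m := le_max_left _ _
  have hbm : |b| ≤ m := le_max_right _ _
  have hh : 0 < h := lt_of_lt_of_le hab hmh
  let f : ℤ × ℤ → ℤ := fun p => p.1 * b - p.2 * a
  have himage : q * (#(S.image f) : ℤ) ≤ 2 * m * h + q := by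
    refine card_mul_le_of_separated _ _ _ hq (by positivity) ?_ ?_
    · intro x hx y hy hxy
      obtain ⟨p, hp, rfl⟩ := mem_image.mp hx
      obtain ⟨p', hp', rfl⟩ := mem_image.mp hy
      exact Int.le_of_dvd (abs_pos.mpr (sub_ne_zero.mpr hxy))
        ((dvd_abs _ _).mpr (dvd_sub (hdvd p hp) (hdvd p' hp')))
    · intro x hx y hy
      obtain ⟨p, hp, rfl⟩ := mem_image.mp hx
      obtain ⟨p', hp', rfl⟩ := mem_image.mp hy
      obtain ⟨h1, h2⟩ := hdiam p hp p' hp'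
      calc |f p - f p'| = |(p.1 - p'.1) * b - (p.2 - p'.2) * a| := by congr 1; simp only [f]; ring
        _ ≤ |p.1 - p'.1| * |b| + |p.2 - p'.2| * |a| := by
          rw [← abs_mul, ← abs_mul]; exact abs_sub _ _
        _ ≤ h * m + h * m := by gcongr
        _ = 2 * m * h := by ring
  have hfiber : ∀ c ∈ S.image f, #{p ∈ S | f p = c} ≤ (2 * h / m).toNat := by
    intro c _
    have key : m * (#{p ∈ S | f p = c} : ℤ) ≤ h + m := by
      have hline : ∀ p p' : ℤ × ℤ, f p = c → f p' = c →
          |p.1 - p'.1| * |b| = |p.2 - p'.2| * |a| := by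
        intro p p' hp hp'
        rw [← abs_mul, ← abs_mul]
        congr 1
        simp only [f] at hp hp'
        linarith
      rcases le_total |b| |a| with hle | hle
      · have hma : m = |a| := max_eq_left hle
        have hdom : ∀ p p' : ℤ × ℤ, f p = c → f p' = c → |p.2 - p'.2| ≤ |p.1 - p'.1| := by
          intro p p' hp hp'
          have := hline p p' hp hp'
          refine le_of_mul_le_mul_right (a := |a|) ?_ (by omega)
          rw [← this]
          gcongr
        have hinj : Set.InjOn Prod.fst (↑({p ∈ S | f p = c}) : Set (ℤ × ℤ)) := by
          intro p hp p' hp' heq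
          simp only [coe_filter, Set.mem_ofPred_eq] at hp hp'
          have := hdom p p' hp.2 hp'.2
          rw [heq, sub_self, abs_zero] at this
          exact Prod.ext heq (sub_eq_zero.mp (abs_nonpos_iff.mp this))
        rw [← card_image_of_injOn hinj]
        refine card_mul_le_of_separated _ _ _ hab hh.le ?_ ?_
        · intro x hx y hy hxy
          obtain ⟨p, hp, rfl⟩ := mem_image.mp hx
          obtain ⟨p', hp', rfl⟩ := mem_image.mp hy
          rw [mem_filter] at hp hp'
          have := hsep p hp.1 p' hp'.1 (fun he => hxy (by rw [he]))
          rwa [max_eq_left (hdom p p' hp.2 hp'.2)] at this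
        · intro x hx y hy
          obtain ⟨p, hp, rfl⟩ := mem_image.mp hx
          obtain ⟨p', hp', rfl⟩ := mem_image.mp hy
          rw [mem_filter] at hp hp'
          exact (hdiam p hp.1 p' hp'.1).1
      · have hmb : m = |b| := max_eq_right hle
        have hdom : ∀ p p' : ℤ × ℤ, f p = c → f p' = c → |p.1 - p'.1| ≤ |p.2 - p'.2| := by
          intro p p' hp hp'
          have := hline p p' hp hp'
          refine le_of_mul_le_mul_right (a := |b|) ?_ (by omega)
          rw [this]
          gcongr
        have hinj : Set.InjOn Prod.snd (↑({p ∈ S | f p = c}) : Set (ℤ × ℤ)) := by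
          intro p hp p' hp' heq
          simp only [coe_filter, Set.mem_ofPred_eq] at hp hp'
          have := hdom p p' hp.2 hp'.2
          rw [heq, sub_self, abs_zero] at this
          exact Prod.ext (sub_eq_zero.mp (abs_nonpos_iff.mp this)) heq
        rw [← card_image_of_injOn hinj]
        refine card_mul_le_of_separated _ _ _ hab hh.le ?_ ?_
        · intro x hx y hy hxy
          obtain ⟨p, hp, rfl⟩ := mem_image.mp hx
          obtain ⟨p', hp', rfl⟩ := mem_image.mp hy
          rw [mem_filter] at hp hp'
          have := hsep p hp.1 p' hp'.1 (fun he => hxy (by rw [he]))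
          rwa [max_eq_right (hdom p p' hp.2 hp'.2)] at this
        · intro x hx y hy
          obtain ⟨p, hp, rfl⟩ := mem_image.mp hx
          obtain ⟨p', hp', rfl⟩ := mem_image.mp hy
          rw [mem_filter] at hp hp'
          exact (hdiam p hp.1 p' hp'.1).2
    have : (#{p ∈ S | f p = c} : ℤ) ≤ 2 * h / m := by
      rw [Int.le_ediv_iff_mul_le hab]
      linarith
    omega
  have hcard := card_le_mul_card_image S _ hfiber
  have hn0 : 0 ≤ 2 * h / m := Int.ediv_nonneg (by omega) hab.le
  have hcard' : (#S : ℤ) ≤ 2 * h / m * #(S.image f) := by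
    have : (#S : ℤ) ≤ ((2 * h / m).toNat : ℤ) * #(S.image f) := by exact_mod_cast hcard
    rwa [Int.toNat_of_nonneg hn0] at this
  have hn : m * (2 * h / m) ≤ 2 * h := Int.mul_ediv_self_le hab.ne'
  calc q * m * (#S : ℤ) ≤ q * m * (2 * h / m * #(S.image f)) := by gcongr
    _ = (m * (2 * h / m)) * (q * #(S.image f)) := by ring
    _ ≤ 2 * h * (2 * m * h + q) := by gcongr

open Finset in
theorem card_units_mul_eq_le (q : ℕ) [NeZero q] (a b : ℤ) (H : ℕ) (hb : b ≠ 0)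
    (hbH : |b| ≤ H) :
    #{l : (ZMod q)ˣ | (a : ZMod q) = l * b} ≤
      ∑ g ∈ Icc 1 H with (((g : ℕ) : ℤ) ∣ a ∧ ((g : ℕ) : ℤ) ∣ b), g := by
  rcases Finset.eq_empty_or_nonempty ({l : (ZMod q)ˣ | (a : ZMod q) = l * b} : Finset _)
    with he | ⟨l₀, hl₀⟩
  · rw [he]; simp
  simp only [mem_filter, mem_univ, true_and] at hl₀
  set g := Int.gcd b q with hg
  have hgb : (g : ℤ) ∣ b := Int.gcd_dvd_left _ _
  have hgq : (g : ℤ) ∣ q := Int.gcd_dvd_right _ _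
  have hgpos : 0 < g := Int.gcd_pos_of_ne_zero_left _ hb
  have hgH : g ≤ H := by
    have := Int.le_of_dvd (abs_pos.mpr hb) ((dvd_abs _ _).mpr hgb)
    omega
  have hga : (g : ℤ) ∣ a := by
    have hgq' : g ∣ q := by exact_mod_cast hgq
    have := congrArg (ZMod.castHom hgq' (ZMod g)) hl₀
    rw [map_mul, map_intCast, map_intCast, (ZMod.intCast_zmod_eq_zero_iff_dvd b g).mpr hgb,
      mul_zero] at this
    exact (ZMod.intCast_zmod_eq_zero_iff_dvd a g).mp this
  have hbez : (g : ZMod q) = b * (Int.gcdA b q : ZMod q) := by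
    have := congrArg (Int.cast : ℤ → ZMod q) (Int.gcd_eq_gcd_ab b q)
    simpa using this
  calc #{l : (ZMod q)ˣ | (a : ZMod q) = l * b}
      ≤ #{x : ZMod q | g • x = 0} := by
        refine card_le_card_of_injOn (fun l => (l : ZMod q) - l₀) ?_ ?_
        · intro l hl
          simp only [coe_filter, mem_univ, true_and, Set.mem_ofPred_eq] at hl ⊢
          rw [nsmul_eq_mul, hbez]
          linear_combination (Int.gcdA b q : ZMod q) * (hl₀ - hl)
        · intro l _ l' _ hll
          exact Units.ext (by simpa using hll)
    _ ≤ g := IsAddCyclic.card_nsmul_eq_zero_le hgpos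
    _ ≤ _ := by
        refine single_le_sum (f := fun g : ℕ => g) (fun _ _ => Nat.zero_le _) ?_
        simp only [mem_filter, mem_Icc]
        exact ⟨⟨hgpos, hgH⟩, hga, hgb⟩

open Finset in
theorem sum_inv_multiples_le (H g : ℕ) (hg : 0 < g) :
    ∑ a ∈ Icc 1 H with g ∣ a, (1 / a : ℝ) ≤ (1 / g) * ∑ k ∈ Icc 1 H, (1 / k : ℝ) := by
  have hsub : ({a ∈ Icc 1 H | g ∣ a} : Finset ℕ) ⊆ (Icc 1 H).image (g * ·) := by
    intro a ha
    simp only [mem_filter, mem_Icc] at ha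
    obtain ⟨⟨h1, h2⟩, k, rfl⟩ := ha
    simp only [mem_image, mem_Icc]
    have hk : 0 < k := Nat.pos_of_ne_zero (by rintro rfl; simp at h1)
    exact ⟨k, ⟨hk, le_trans (Nat.le_mul_of_pos_left k hg) h2⟩, rfl⟩
  calc ∑ a ∈ Icc 1 H with g ∣ a, (1 / a : ℝ)
      ≤ ∑ a ∈ (Icc 1 H).image (g * ·), (1 / a : ℝ) :=
        sum_le_sum_of_subset_of_nonneg hsub (fun _ _ _ => by positivity)
    _ = ∑ k ∈ Icc 1 H, (1 / (g * k : ℕ) : ℝ) :=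
        sum_image (fun x _ y _ hxy => Nat.eq_of_mul_eq_mul_left hg hxy)
    _ = (1 / g) * ∑ k ∈ Icc 1 H, (1 / k : ℝ) := by
        rw [mul_sum]
        refine sum_congr rfl fun k _ => ?_
        push_cast
        rw [one_div_mul_one_div]

open Finset in
theorem sum_common_divisors_div_le (H : ℕ) :
    ∑ v ∈ Icc 1 H ×ˢ Icc 1 H,
      (∑ g ∈ Icc 1 H with (g ∣ v.1 ∧ g ∣ v.2), (g : ℝ)) * (1 / (v.1 * v.2 : ℝ)) ≤
      (1 + Real.log H) ^ 3 := by
  set L := ∑ k ∈ Icc 1 H, (1 / k : ℝ) with hL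
  have hL0 : 0 ≤ L := sum_nonneg fun _ _ => by positivity
  have hLlog : L ≤ 1 + Real.log H := by
    have := harmonic_le_one_add_log H
    rw [harmonic_eq_sum_Icc] at this
    simpa [hL] using this
  have hswap : ∑ v ∈ Icc 1 H ×ˢ Icc 1 H,
      (∑ g ∈ Icc 1 H with (g ∣ v.1 ∧ g ∣ v.2), (g : ℝ)) * (1 / (v.1 * v.2 : ℝ)) =
      ∑ g ∈ Icc 1 H, (g : ℝ) * (∑ a ∈ Icc 1 H with g ∣ a, (1 / a : ℝ)) ^ 2 := by
    simp_rw [sq, sum_mul_sum, ← sum_product', ← filter_product, sum_filter, mul_sum, sum_mul]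
    rw [sum_comm]
    refine sum_congr rfl fun g _ => sum_congr rfl fun v _ => ?_
    split_ifs
    · rw [one_div_mul_one_div]
    · simp
  rw [hswap]
  calc ∑ g ∈ Icc 1 H, (g : ℝ) * (∑ a ∈ Icc 1 H with g ∣ a, (1 / a : ℝ)) ^ 2
      ≤ ∑ g ∈ Icc 1 H, (1 / g : ℝ) * L ^ 2 := by
        refine sum_le_sum fun g hg => ?_
        have hg0 : 0 < g := (mem_Icc.mp hg).1
        have hg0' : (0 : ℝ) < g := by exact_mod_cast hg0
        calc (g : ℝ) * (∑ a ∈ Icc 1 H with g ∣ a, (1 / a : ℝ)) ^ 2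
            ≤ g * ((1 / g) * L) ^ 2 := by
              gcongr
              exact sum_inv_multiples_le H g hg0
          _ = (1 / g : ℝ) * L ^ 2 := by field_simp
    _ = L ^ 3 := by rw [← sum_mul]; ring
    _ ≤ _ := by gcongr

open Finset Classical in
/-- The points of the square `(u, u + h]²` with unit second coordinate on the lattice of slope `l`
modulo `q`. -/
noncomputable def sloped (q : ℕ) (u h : ℤ) (l : (ZMod q)ˣ) : Finset (ℤ × ℤ) :=
  {p ∈ Icc (u + 1) (u + h) ×ˢ Icc (u + 1) (u + h) |
    IsUnit (p.2 : ZMod q) ∧ (p.1 : ZMod q) = l * p.2}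

theorem mem_sloped {q : ℕ} {u h : ℤ} {l : (ZMod q)ˣ} {p : ℤ × ℤ} :
    p ∈ sloped q u h l ↔ ((u + 1 ≤ p.1 ∧ p.1 ≤ u + h) ∧ (u + 1 ≤ p.2 ∧ p.2 ≤ u + h)) ∧
      IsUnit (p.2 : ZMod q) ∧ (p.1 : ZMod q) = l * p.2 := by
  simp [sloped]

open Finset in
theorem sum_card_sloped_le (q : ℕ) [NeZero q] (u : ℤ) (H : ℕ) :
    ∑ l : (ZMod q)ˣ, #(sloped q u H l) ≤ H ^ 2 := by
  rw [← card_sigma]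
  calc _ ≤ #(Icc (u + 1) (u + H) ×ˢ Icc (u + 1) (u + H)) := by
        refine card_le_card_of_injOn (fun x => x.2) ?_ ?_
        · rintro ⟨l, p⟩ hp
          simp only [coe_sigma, Set.mem_sigma_iff, mem_coe, mem_sloped] at hp
          simp only [mem_coe, mem_product, mem_Icc]
          exact hp.2.1
        · rintro ⟨l, p⟩ hp ⟨l', p'⟩ hp' heq
          simp only at heq
          subst heq
          simp only [coe_sigma, Set.mem_sigma_iff, mem_coe, mem_sloped] at hp hp'
          have : l = l' := Units.ext (hp.2.2.1.mul_right_cancel (hp.2.2.2.symm.trans hp'.2.2.2))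
          rw [this]
    _ = H ^ 2 := by
        rw [card_product, Int.card_Icc]
        have : (u + H + 1 - (u + 1)).toNat = H := by omega
        rw [this, sq]

open Finset in
theorem ncard_solutions_le (q : ℕ) [NeZero q] (u h : ℤ) :
    {t : ℤ × ℤ × ℤ × ℤ |
          t.1 ∈ Set.Icc (u + 1) (u + h) ∧ t.2.1 ∈ Set.Icc (u + 1) (u + h) ∧
          t.2.2.1 ∈ Set.Icc (u + 1) (u + h) ∧ t.2.2.2 ∈ Set.Icc (u + 1) (u + h) ∧
          Int.gcd (t.1 * t.2.1 * t.2.2.1 * t.2.2.2) q = 1 ∧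
          (q : ℤ) ∣ t.1 * t.2.1 - t.2.2.1 * t.2.2.2}.ncard ≤
      ∑ l : (ZMod q)ˣ, #(sloped q u h l) ^ 2 := by
  have hsum : ∑ l : (ZMod q)ˣ, #(sloped q u h l) ^ 2 =
      #((univ : Finset (ZMod q)ˣ).sigma fun l => sloped q u h l ×ˢ sloped q u h l) := by
    simp [card_sigma, sq]
  rw [hsum]
  refine le_trans ?_ (card_image_le
    (f := fun x : (_ : (ZMod q)ˣ) × (ℤ × ℤ) × (ℤ × ℤ) => (x.2.1.1, x.2.2.2, x.2.1.2, x.2.2.1)))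
  rw [← Set.ncard_coe_finset]
  refine Set.ncard_le_ncard ?_ (finite_toSet _)
  rintro ⟨w, x, y, z⟩ ⟨hw, hx, hy, hz, hgcd, hdvd⟩
  simp only [Set.mem_Icc] at hw hx hy hz hgcd hdvd
  have hunit : IsUnit ((w * x * y * z : ℤ) : ZMod q) :=
    (ZMod.coe_int_isUnit_iff_isCoprime _ _).mpr (Int.isCoprime_iff_gcd_eq_one.mpr hgcd).symm
  push_cast at hunit
  simp only [IsUnit.mul_iff] at hunit
  obtain ⟨⟨⟨hw', hx'⟩, hy'⟩, hz'⟩ := hunit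
  have heq : (w : ZMod q) * x = y * z := by
    have := (ZMod.intCast_zmod_eq_zero_iff_dvd _ q).mpr hdvd
    push_cast at this
    exact sub_eq_zero.mp this
  obtain ⟨w₁, hw₁⟩ := hw'
  obtain ⟨y₁, hy₁⟩ := hy'
  simp only [coe_image, Set.mem_image, mem_coe, mem_sigma, mem_univ, true_and, mem_product,
    mem_sloped]
  refine ⟨⟨w₁ * y₁⁻¹, (w, y), (z, x)⟩, ⟨⟨⟨hw, hy⟩, ⟨y₁, hy₁⟩, ?_⟩, ⟨⟨hz, hx⟩, hx', ?_⟩⟩, rfl⟩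
  · simp [← hw₁, ← hy₁]
  · have : (y₁ : ZMod q) * z = y₁ * (((w₁ * y₁⁻¹ : (ZMod q)ˣ) : ZMod q) * x) := by
      rw [hy₁, ← heq, ← hw₁, ← hy₁]
      push_cast
      linear_combination (-(w₁ : ZMod q) * x) * y₁.mul_inv
    exact y₁.isUnit.mul_left_cancel this

open Finset in
theorem exists_short_vector (q : ℕ) [NeZero q] (u h : ℤ) (hhq : h ≤ q) (l : (ZMod q)ˣ)
    (hS : 2 ≤ #(sloped q u h l)) :
    ∃ a b : ℤ, a ≠ 0 ∧ b ≠ 0 ∧ |a| ≤ h ∧ |b| ≤ h ∧ (a : ZMod q) = l * b ∧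
      q * max |a| |b| * (#(sloped q u h l) : ℤ) ≤ 2 * h * (2 * max |a| |b| * h + q) := by
  have hq : (0 : ℤ) < q := by exact_mod_cast Nat.pos_of_ne_zero (NeZero.ne q)
  let V : Finset (ℤ × ℤ) := {v ∈ Ioo (-h) h ×ˢ Ioo (-h) h | v ≠ 0 ∧ (v.1 : ZMod q) = l * v.2}
  have hdiff : ∀ p ∈ sloped q u h l, ∀ p' ∈ sloped q u h l, p ≠ p' → p - p' ∈ V := by
    intro p hp p' hp' hne
    rw [mem_sloped] at hp hp'
    simp only [V, mem_filter, mem_product, mem_Ioo, Prod.fst_sub, Prod.snd_sub]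
    refine ⟨by omega, sub_ne_zero.mpr hne, ?_⟩
    push_cast
    rw [hp.2.2, hp'.2.2, mul_sub]
  obtain ⟨p, hp, p', hp', hne⟩ := one_lt_card.mp hS
  obtain ⟨⟨a, b⟩, hv, hmin⟩ := exists_min_image V (fun v => max |v.1| |v.2|)
    ⟨_, hdiff p hp p' hp' hne⟩
  simp only [V, mem_filter, mem_product, mem_Ioo] at hv
  obtain ⟨⟨ha, hb⟩, hv0, hab⟩ := hv
  have hzero : ∀ c : ℤ, |c| < h → (c : ZMod q) = 0 → c = 0 := by
    intro c hc hc0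
    exact Int.eq_zero_of_abs_lt_dvd ((ZMod.intCast_zmod_eq_zero_iff_dvd c q).mp hc0)
      (lt_of_lt_of_le hc hhq)
  have hb0 : b ≠ 0 := by
    rintro rfl
    have : a = 0 := hzero a (abs_lt.mpr ha) (by simpa using hab)
    exact hv0 (by rw [this]; rfl)
  have ha0 : a ≠ 0 := by
    rintro rfl
    refine hb0 (hzero b (abs_lt.mpr hb) ?_)
    exact l.isUnit.mul_left_cancel (by simpa using hab.symm)
  refine ⟨a, b, ha0, hb0, (abs_lt.mpr ha).le, (abs_lt.mpr hb).le, hab, ?_⟩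
  refine card_mul_le_of_det_dvd _ q h a b hq (lt_max_of_lt_left (abs_pos.mpr ha0))
    (max_le (abs_lt.mpr ha).le (abs_lt.mpr hb).le) ?_ ?_ ?_
  · intro p hp p' hp'
    rw [mem_sloped] at hp hp'
    simp only [abs_le]
    omega
  · intro p hp p' hp' hne
    exact hmin _ (hdiff p hp p' hp' hne)
  · intro p hp
    rw [mem_sloped] at hp
    rw [← ZMod.intCast_zmod_eq_zero_iff_dvd]
    push_cast
    rw [hp.2.2, hab]
    ring

open Finset in
theorem exists_sq_card_sloped_le (q : ℕ) [NeZero q] (u : ℤ) (H : ℕ) (hHq : H ≤ q) (l : (ZMod q)ˣ)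
    (hS : 2 ≤ #(sloped q u H l)) :
    ∃ v ∈ Icc 1 H ×ˢ Icc 1 H,
      (((v.1 : ℤ) : ZMod q) = l * ((v.2 : ℤ) : ZMod q) ∨
        ((v.1 : ℤ) : ZMod q) = l * ((-v.2 : ℤ) : ZMod q)) ∧
      (#(sloped q u H l) : ℝ) ^ 2 ≤
        8 * H ^ 2 / q * #(sloped q u H l) + 16 * H ^ 2 * (1 / (v.1 * v.2)) := by
  obtain ⟨a, b, ha0, hb0, ha, hb, hab, hcard⟩ :=
    exists_short_vector q u H (by exact_mod_cast hHq) l hS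
  refine ⟨(a.natAbs, b.natAbs), ?_, ?_, ?_⟩
  · rw [← Int.natCast_natAbs] at ha hb
    simp only [mem_product, mem_Icc]
    omega
  · simp only [Int.natCast_natAbs]
    rcases abs_choice a with h1 | h1 <;> rcases abs_choice b with h2 | h2 <;> rw [h1, h2] <;>
      push_cast <;> rw [hab] <;> simp
  · have hq : (0 : ℝ) < q := by exact_mod_cast Nat.pos_of_ne_zero (NeZero.ne q)
    set n : ℝ := (#(sloped q u H l) : ℝ) with hn
    have hn0 : 0 ≤ n := Nat.cast_nonneg _
    set α : ℝ := ((a.natAbs : ℕ) : ℝ) with hα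
    set β : ℝ := ((b.natAbs : ℕ) : ℝ) with hβ
    have hα0 : 0 < α := by rw [hα]; exact_mod_cast Int.natAbs_pos.mpr ha0
    have hβ0 : 0 < β := by rw [hβ]; exact_mod_cast Int.natAbs_pos.mpr hb0
    set m : ℝ := max α β with hm
    have hm0 : 0 < m := lt_max_of_lt_left hα0
    have hcard' : q * m * n ≤ 2 * H * (2 * m * H + q) := by
      have h := (Int.cast_le (R := ℝ)).mpr hcard
      push_cast at h
      simpa [hm, hα, hβ, hn, Nat.cast_natAbs] using h
    have hle : n ≤ 4 * H ^ 2 / q + 2 * H / m := by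
      rw [div_add_div _ _ hq.ne' hm0.ne', le_div_iff₀ (by positivity)]
      linarith
    have hprod : (1 : ℝ) / m ^ 2 ≤ 1 / (α * β) := by
      refine one_div_le_one_div_of_le (by positivity) ?_
      rw [sq]
      exact mul_le_mul (le_max_left _ _) (le_max_right _ _) hβ0.le hm0.le
    have hA : 16 * (H : ℝ) ^ 2 * (1 / m ^ 2) ≤ 16 * H ^ 2 * (1 / (α * β)) := by gcongr
    have hA' : 16 * (H : ℝ) ^ 2 * (1 / m ^ 2) = 4 * (2 * H / m) ^ 2 := by field_simp; ring
    have hB : 8 * (H : ℝ) ^ 2 / q * n = 2 * (4 * H ^ 2 / q) * n := by ring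
    rw [hB]
    refine le_trans ?_ (add_le_add_right hA _)
    rw [hA']
    have hX : 0 ≤ 4 * (H : ℝ) ^ 2 / q := by positivity
    have hY : 0 ≤ 2 * (H : ℝ) / m := by positivity
    generalize 4 * (H : ℝ) ^ 2 / q = X at *
    generalize 2 * (H : ℝ) / m = Y at *
    rcases le_total X Y with h | h <;> nlinarith [mul_nonneg hX hn0]

open Finset in
theorem sum_sq_card_sloped_le (q : ℕ) [NeZero q] (u : ℤ) (H : ℕ) (hHq : H ≤ q) :
    ∑ l : (ZMod q)ˣ, (#(sloped q u H l) : ℝ) ^ 2 ≤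
      H ^ 2 + 8 * H ^ 4 / q + 32 * H ^ 2 * (1 + Real.log H) ^ 3 := by
  have hq : (0 : ℝ) < q := by exact_mod_cast Nat.pos_of_ne_zero (NeZero.ne q)
  let R : (ZMod q)ˣ → ℕ × ℕ → Prop := fun l v =>
    ((v.1 : ℤ) : ZMod q) = l * ((v.2 : ℤ) : ZMod q) ∨
      ((v.1 : ℤ) : ZMod q) = l * ((-v.2 : ℤ) : ZMod q)
  classical
  have hpoint : ∀ l : (ZMod q)ˣ, (#(sloped q u H l) : ℝ) ^ 2 ≤
      (1 + 8 * H ^ 2 / q) * #(sloped q u H l) + 16 * H ^ 2 *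
        ∑ v ∈ Icc 1 H ×ˢ Icc 1 H, if R l v then (1 / (v.1 * v.2) : ℝ) else 0 := by
    intro l
    have hnn : ∀ v ∈ Icc 1 H ×ˢ Icc 1 H, (0 : ℝ) ≤ if R l v then (1 / (v.1 * v.2) : ℝ) else 0 :=
      fun v _ => by split_ifs <;> positivity
    rcases lt_or_ge #(sloped q u H l) 2 with hlt | hge
    · have h1 : (#(sloped q u H l) : ℝ) ≤ 1 := by exact_mod_cast Nat.lt_succ_iff.mp hlt
      have h0 : (0 : ℝ) ≤ #(sloped q u H l) := Nat.cast_nonneg _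
      have h2 : 0 ≤ 8 * (H : ℝ) ^ 2 / q * #(sloped q u H l) := by positivity
      have h3 := mul_nonneg (by positivity : (0 : ℝ) ≤ 16 * H ^ 2) (sum_nonneg hnn)
      nlinarith
    · obtain ⟨v, hv, hR, hle⟩ := exists_sq_card_sloped_le q u H hHq l hge
      have hs := single_le_sum hnn hv
      rw [if_pos hR] at hs
      have h0 : (0 : ℝ) ≤ #(sloped q u H l) := Nat.cast_nonneg _
      have := mul_le_mul_of_nonneg_left hs (by positivity : (0 : ℝ) ≤ 16 * H ^ 2)
      linarith
  have hcount : ∀ v ∈ Icc 1 H ×ˢ Icc 1 H, (#{l : (ZMod q)ˣ | R l v} : ℝ) ≤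
      2 * ∑ g ∈ Icc 1 H with (g ∣ v.1 ∧ g ∣ v.2), (g : ℝ) := by
    intro v hv
    simp only [mem_product, mem_Icc] at hv
    have h1 := card_units_mul_eq_le q v.1 v.2 H (by omega) (by simp; omega)
    have h2 := card_units_mul_eq_le q v.1 (-v.2) H (by omega) (by simp; omega)
    simp only [dvd_neg, Int.natCast_dvd_natCast] at h1 h2
    have h3 : #{l : (ZMod q)ˣ | R l v} ≤
        #{l : (ZMod q)ˣ | ((v.1 : ℤ) : ZMod q) = l * ((v.2 : ℤ) : ZMod q)} +
        #{l : (ZMod q)ˣ | ((v.1 : ℤ) : ZMod q) = l * ((-v.2 : ℤ) : ZMod q)} := by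
      refine (card_le_card fun l hl => ?_).trans (card_union_le _ _)
      simpa [R] using hl
    have h4 : #{l : (ZMod q)ˣ | R l v} ≤ 2 * ∑ g ∈ Icc 1 H with (g ∣ v.1 ∧ g ∣ v.2), g := by
      omega
    have h5 := (Nat.cast_le (α := ℝ)).mpr h4
    rwa [Nat.cast_mul, Nat.cast_sum, Nat.cast_ofNat] at h5
  have hdouble : ∑ l : (ZMod q)ˣ, ∑ v ∈ Icc 1 H ×ˢ Icc 1 H,
      (if R l v then (1 / (v.1 * v.2) : ℝ) else 0) ≤ 2 * (1 + Real.log H) ^ 3 := by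
    rw [sum_comm]
    calc _ = ∑ v ∈ Icc 1 H ×ˢ Icc 1 H,
          (#{l : (ZMod q)ˣ | R l v} : ℝ) * (1 / (v.1 * v.2) : ℝ) := by
          refine sum_congr rfl fun v _ => ?_
          rw [← sum_filter, sum_const, nsmul_eq_mul]
      _ ≤ ∑ v ∈ Icc 1 H ×ˢ Icc 1 H,
          2 * ((∑ g ∈ Icc 1 H with (g ∣ v.1 ∧ g ∣ v.2), (g : ℝ)) * (1 / (v.1 * v.2 : ℝ))) := by
          refine sum_le_sum fun v hv => ?_
          rw [← mul_assoc]
          exact mul_le_mul_of_nonneg_right (hcount v hv) (by positivity)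
      _ ≤ _ := by
          rw [← mul_sum]
          exact mul_le_mul_of_nonneg_left (sum_common_divisors_div_le H) (by norm_num)
  have hlin : ∑ l : (ZMod q)ˣ, (#(sloped q u H l) : ℝ) ≤ H ^ 2 := by
    exact_mod_cast sum_card_sloped_le q u H
  calc _ ≤ (1 + 8 * H ^ 2 / q) * ∑ l : (ZMod q)ˣ, (#(sloped q u H l) : ℝ) + 16 * H ^ 2 *
        ∑ l : (ZMod q)ˣ, ∑ v ∈ Icc 1 H ×ˢ Icc 1 H,
          (if R l v then (1 / (v.1 * v.2) : ℝ) else 0) := by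
        rw [mul_sum, mul_sum, ← sum_add_distrib]
        exact sum_le_sum fun l _ => hpoint l
    _ ≤ (1 + 8 * H ^ 2 / q) * H ^ 2 + 16 * H ^ 2 * (2 * (1 + Real.log H) ^ 3) := by gcongr
    _ = _ := by ring

theorem one_add_log_pow_three_le {ε x : ℝ} (hε : 0 < ε) (hx : 1 ≤ x) :
    (1 + Real.log x) ^ 3 ≤ (1 + 3 / ε) ^ 3 * x ^ ε := by
  have hx0 : 0 ≤ x := by linarith
  have h1 : Real.log x ≤ x ^ (ε / 3) / (ε / 3) := Real.log_le_rpow_div hx0 (by positivity)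
  have h2 : 1 ≤ x ^ (ε / 3) := Real.one_le_rpow hx (by positivity)
  have h3 : 1 + Real.log x ≤ (1 + 3 / ε) * x ^ (ε / 3) := by
    have : x ^ (ε / 3) / (ε / 3) = 3 / ε * x ^ (ε / 3) := by field_simp
    linarith
  have h4 : (x ^ (ε / 3)) ^ 3 = x ^ ε := by
    rw [← Real.rpow_natCast, ← Real.rpow_mul hx0]
    congr 1
    push_cast
    ring
  calc (1 + Real.log x) ^ 3 ≤ ((1 + 3 / ε) * x ^ (ε / 3)) ^ 3 := by
        have := Real.log_nonneg hx
        gcongr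
    _ = _ := by rw [mul_pow, h4]

/-- The multiplicative congruence `wx ≡ yz (mod q)` with unit variables in an
interval of length `h ≤ q` has at most `h^4 q^{-1+ε} + h^{2+ε}` solutions. -/
theorem multiplicative_congruence_bound (ε : ℝ) (hε : 0 < ε) :
    ∃ C : ℝ, ∀ q : ℕ, 1 ≤ q → ∀ u h : ℤ, 1 ≤ h → h ≤ q →
      ({t : ℤ × ℤ × ℤ × ℤ |
          t.1 ∈ Set.Icc (u + 1) (u + h) ∧ t.2.1 ∈ Set.Icc (u + 1) (u + h) ∧
          t.2.2.1 ∈ Set.Icc (u + 1) (u + h) ∧ t.2.2.2 ∈ Set.Icc (u + 1) (u + h) ∧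
          Int.gcd (t.1 * t.2.1 * t.2.2.1 * t.2.2.2) q = 1 ∧
          (q : ℤ) ∣ t.1 * t.2.1 - t.2.2.1 * t.2.2.2}.ncard : ℝ)
        ≤ C * ((h : ℝ) ^ 4 * (q : ℝ) ^ (-1 + ε : ℝ) + (h : ℝ) ^ (2 + ε : ℝ)) := by
  set K : ℝ := (1 + 3 / ε) ^ 3
  have hK : 0 ≤ K := by positivity
  refine ⟨9 + 32 * K, fun q hq u h hh hhq => ?_⟩
  have : NeZero q := ⟨by omega⟩
  lift h to ℕ using by omega
  have hcount := ncard_solutions_le q u h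
  have hsum := sum_sq_card_sloped_le q u h (by exact_mod_cast hhq)
  have hx : (1 : ℝ) ≤ h := by exact_mod_cast hh
  have hq1 : (1 : ℝ) ≤ q := by exact_mod_cast hq
  have hlog := one_add_log_pow_three_le hε hx
  have hpow : (h : ℝ) ^ (2 + ε) = (h : ℝ) ^ 2 * (h : ℝ) ^ ε := by
    rw [Real.rpow_add (by linarith), Real.rpow_two]
  have hqpow : (1 : ℝ) / q ≤ (q : ℝ) ^ (-1 + ε) := by
    rw [one_div, ← Real.rpow_neg_one]
    exact Real.rpow_le_rpow_of_exponent_le hq1 (by linarith)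
  have hhpow : (1 : ℝ) ≤ (h : ℝ) ^ ε := Real.one_le_rpow hx hε.le
  simp only [Int.cast_natCast]
  rw [hpow]
  refine le_trans (Nat.cast_le.mpr hcount) ?_
  push_cast
  refine hsum.trans ?_
  have e1 : (h : ℝ) ^ 2 ≤ h ^ 2 * h ^ ε := le_mul_of_one_le_right (by positivity) hhpow
  have e2 : 8 * (h : ℝ) ^ 4 / q ≤ 8 * (h ^ 4 * (q : ℝ) ^ (-1 + ε)) := by
    have := mul_le_mul_of_nonneg_left hqpow (by positivity : (0 : ℝ) ≤ 8 * h ^ 4)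
    calc 8 * (h : ℝ) ^ 4 / q = 8 * h ^ 4 * (1 / q) := by ring
      _ ≤ _ := by linarith
  have e3 : 32 * (h : ℝ) ^ 2 * (1 + Real.log h) ^ 3 ≤ 32 * K * (h ^ 2 * h ^ ε) := by
    have := mul_le_mul_of_nonneg_left hlog (by positivity : (0 : ℝ) ≤ 32 * h ^ 2)
    linarith
  have e4 : 0 ≤ (h : ℝ) ^ 4 * (q : ℝ) ^ (-1 + ε) := by positivity
  have e5 : 0 ≤ (h : ℝ) ^ 2 * (h : ℝ) ^ ε := by positivity
  have e6 := mul_nonneg hK e4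
  linarith
end

section
/- Let p be prime, χ a Dirichlet character modulo p, λ ∈ F_p, and F(X) ∈ F_p[X] a polynomial of degree at least 2. Then for any integers u and h with 1 ≤ h ≤ p, provided (χ, λ) ≠ (χ_0, 0), one has |∑_{x=u+1}^{u+h} χ(x)·e(λF(x)/p)| ≪ p^{1/2}·log p, with implied constant depending only on deg F. -/
section WeightFiltration

open Module

/-- A basis of the `K`-algebra `A` on which a valuation, trivial on `K`, takes pairwise distinct
natural powers of a fixed element `γ > 1`. -/
structure WeightedBasis (K A ι Γ₀ : Type*) [Field K] [CommRing A] [Algebra K A]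
    [LinearOrderedCommGroupWithZero Γ₀] where
  basis : Basis ι K A
  val : Valuation A Γ₀
  γ : Γ₀
  weight : ι → ℕ
  one_lt : 1 < γ
  inj : Function.Injective weight
  val_basis : ∀ i, val (basis i) = γ ^ weight i
  val_const : ∀ c : K, c ≠ 0 → val (algebraMap K A c) = 1

namespace WeightedBasis

variable {K A ι Γ₀ : Type*} [Field K] [CommRing A] [Algebra K A]
  [LinearOrderedCommGroupWithZero Γ₀] (B : WeightedBasis K A ι Γ₀)

theorem finite_weight_le (n : ℕ) : {i | B.weight i ≤ n}.Finite :=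
  (Set.finite_Iic n).preimage B.inj.injOn

/-- The indices of weight at most `n`. -/
noncomputable def indices (n : ℕ) : Finset ι := (B.finite_weight_le n).toFinset

@[simp] theorem mem_indices {n : ℕ} {i : ι} : i ∈ B.indices n ↔ B.weight i ≤ n := by
  simp [indices]

/-- The span of the basis vectors of weight at most `n`. -/
noncomputable def filtration (n : ℕ) : Submodule K A :=
  Submodule.span K (Set.range fun i : B.indices n => B.basis i)

theorem finrank_filtration (n : ℕ) : finrank K (B.filtration n) = (B.indices n).card := by
  rw [filtration, finrank_span_eq_card (b := fun i : B.indices n => B.basis i)]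
  · simp
  · exact B.basis.linearIndependent.comp _ Subtype.val_injective

instance (n : ℕ) : FiniteDimensional K (B.filtration n) :=
  FiniteDimensional.span_of_finite K (Set.finite_range _)

theorem γ_pos : 0 < B.γ := zero_lt_one.trans B.one_lt

theorem val_smul {c : K} (hc : c ≠ 0) (a : A) : B.val (c • a) = B.val a := by
  rw [Algebra.smul_def, map_mul, B.val_const c hc, one_mul]

theorem val_smul_le (c : K) (a : A) : B.val (c • a) ≤ B.val a := by
  rcases eq_or_ne c 0 with rfl | hc
  · simp
  · exact (B.val_smul hc a).le

theorem exists_val_eq {a : A} (ha : a ≠ 0) :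
    ∃ i ∈ (B.basis.repr a).support, B.val a = B.γ ^ B.weight i ∧
      ∀ j ∈ (B.basis.repr a).support, B.weight j ≤ B.weight i := by
  classical
  have hne : (B.basis.repr a).support.Nonempty := by
    rw [Finsupp.support_nonempty_iff]; simpa using ha
  obtain ⟨i, hi, hmax⟩ := Finset.exists_max_image _ B.weight hne
  refine ⟨i, hi, ?_, hmax⟩
  have h1 : ∀ j ∈ (B.basis.repr a).support,
      B.val ((B.basis.repr a j) • B.basis j) = B.γ ^ B.weight j := fun j hj => by
    rw [B.val_smul (Finsupp.mem_support_iff.mp hj), B.val_basis]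
  conv_lhs => rw [← B.basis.linearCombination_repr a, Finsupp.linearCombination_apply, Finsupp.sum]
  rw [Valuation.map_sum_eq_of_lt B.val hi, h1 i hi]
  intro j hj
  obtain ⟨hj, hji⟩ := Finset.mem_sdiff.mp hj
  rw [h1 i hi, h1 j hj]
  refine pow_lt_pow_right₀ B.one_lt (lt_of_le_of_ne (hmax j hj) fun h => hji ?_)
  simpa using B.inj h

theorem val_ne_zero {a : A} (ha : a ≠ 0) : B.val a ≠ 0 := by
  obtain ⟨i, -, h, -⟩ := B.exists_val_eq ha
  rw [h]; exact pow_ne_zero _ B.γ_pos.ne'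

theorem mem_filtration {n : ℕ} {a : A} : a ∈ B.filtration n ↔ B.val a ≤ B.γ ^ n := by
  constructor
  · intro h
    induction h using Submodule.span_induction with
    | mem x hx =>
      obtain ⟨⟨i, hi⟩, rfl⟩ := hx
      simp only [B.val_basis]
      exact pow_le_pow_right₀ B.one_lt.le (B.mem_indices.mp hi)
    | zero => simp
    | add x y _ _ hx hy => exact B.val.map_add_le hx hy
    | smul c x _ hx => exact (B.val_smul_le c x).trans hx
  · intro h
    rcases eq_or_ne a 0 with rfl | ha
    · exact zero_mem _
    obtain ⟨i, hi, hv, hmax⟩ := B.exists_val_eq ha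
    rw [hv, pow_le_pow_iff_right₀ B.one_lt] at h
    rw [← B.basis.linearCombination_repr a, Finsupp.linearCombination_apply, Finsupp.sum]
    exact Submodule.sum_mem _ fun j hj => Submodule.smul_mem _ _
      (Submodule.subset_span ⟨⟨j, B.mem_indices.mpr ((hmax j hj).trans h)⟩, rfl⟩)

theorem card_indices_le (n w : ℕ) : (B.indices n).card ≤ (B.indices (n - w)).card + w := by
  classical
  have h : (B.indices n \ B.indices (n - w)).card ≤ (Finset.Ioc (n - w) n).card :=
    Finset.card_le_card_of_injOn B.weight (fun i hi => by
      simp only [Finset.coe_sdiff, Set.mem_sdiff, Finset.mem_coe, mem_indices, not_le] at hi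
      simp [hi.1, hi.2]) B.inj.injOn
  have := Finset.card_le_card_sdiff_add_card (s := B.indices n) (t := B.indices (n - w))
  simp only [Nat.card_Ioc] at h
  omega

theorem card_indices_le_succ (n : ℕ) : (B.indices n).card ≤ n + 1 := by
  have h : (B.indices n).card ≤ (Finset.Iic n).card :=
    Finset.card_le_card_of_injOn B.weight (fun i hi => by simpa using hi) B.inj.injOn
  simpa using h

end WeightedBasis

/-- Evaluation at finitely many distinct `K`-points of a `K`-algebra is surjective. -/
theorem AlgHom.pi_surjective {K A : Type*} [Field K] [CommRing A] [Algebra K A]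
    (Z : Finset (A →ₐ[K] K)) :
    Function.Surjective (LinearMap.pi fun φ : Z => (φ : A →ₐ[K] K).toLinearMap) := by
  classical
  rw [← LinearMap.range_eq_top]
  by_contra h
  obtain ⟨f, hf, hle⟩ := Submodule.exists_le_ker_of_lt_top _ (lt_top_iff_ne_top.mpr h)
  have hli := (linearIndependent_algHom_toLinearMap K A K).comp (fun φ : Z => (φ : A →ₐ[K] K))
    Subtype.val_injective
  have hsingle : ∀ φ : Z, (fun j => if φ = j then (1 : K) else 0) = Pi.single φ 1 := fun φ => by
    ext j; simp [Pi.single_apply, eq_comm]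
  refine hf (LinearMap.ext fun x => ?_)
  have hz := Fintype.linearIndependent_iff.mp hli (fun φ => f (Pi.single φ 1)) (by
    ext a
    have := hle ⟨a, rfl⟩
    rw [LinearMap.mem_ker, LinearMap.pi_apply_eq_sum_univ] at this
    simp_rw [hsingle] at this
    simpa [mul_comm] using this)
  rw [LinearMap.pi_apply_eq_sum_univ]
  simp [hsingle, hz]

namespace WeightedBasis

variable {K A ι Γ₀ : Type*} [Field K] [CommRing A] [Algebra K A]
  [LinearOrderedCommGroupWithZero Γ₀] (B : WeightedBasis K A ι Γ₀)

/-- A nonzero element has at most as many zeros as its weight. -/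
theorem card_zeros_le {g : A} (hg : g ≠ 0) {w : ℕ} (hw : B.val g ≤ B.γ ^ w)
    (Z : Finset (A →ₐ[K] K)) (hZ : ∀ φ ∈ Z, φ g = 0) : Z.card ≤ w := by
  classical
  obtain ⟨i, -, hi, -⟩ := B.exists_val_eq hg
  rw [hi, pow_le_pow_iff_right₀ B.one_lt] at hw
  refine le_trans ?_ hw
  set w₀ := B.weight i
  set E : A →ₗ[K] (Z → K) := LinearMap.pi fun φ : Z => (φ : A →ₐ[K] K).toLinearMap
  choose s hs using fun φ : Z => AlgHom.pi_surjective Z (Pi.single φ 1)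
  have hbd : ∀ a : A, ∃ n, a ∈ B.filtration n := fun a => by
    rcases eq_or_ne a 0 with rfl | ha
    · exact ⟨0, zero_mem _⟩
    · obtain ⟨j, -, hj, -⟩ := B.exists_val_eq ha
      exact ⟨B.weight j, B.mem_filtration.mpr hj.le⟩
  choose n hn using fun φ : Z => hbd (s φ)
  set N := (Finset.univ.sup n) + w₀
  have hmono : ∀ {k l : ℕ}, k ≤ l → B.filtration k ≤ B.filtration l := fun hkl a ha =>
    B.mem_filtration.mpr ((B.mem_filtration.mp ha).trans (pow_le_pow_right₀ B.one_lt.le hkl))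
  have hsN : ∀ φ, s φ ∈ B.filtration N := fun φ =>
    hmono ((Finset.le_sup (Finset.mem_univ φ)).trans (Nat.le_add_right _ _)) (hn φ)
  set E' := E.domRestrict (B.filtration N)
  have hsurj : LinearMap.range E' = ⊤ := by
    rw [eq_top_iff, ← (Pi.basisFun K Z).span_eq, Submodule.span_le]
    rintro _ ⟨φ, rfl⟩
    exact ⟨⟨s φ, hsN φ⟩, by simpa [E', E] using hs φ⟩
  have hdim := LinearMap.finrank_range_add_finrank_ker E'
  rw [hsurj, finrank_top, Module.finrank_fintype_fun_eq_card, Fintype.card_coe,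
    B.finrank_filtration] at hdim
  have hmul : ∀ a : B.filtration (N - w₀), g * a ∈ B.filtration N := fun a => by
    rw [B.mem_filtration, map_mul, hi]
    calc B.γ ^ w₀ * B.val a ≤ B.γ ^ w₀ * B.γ ^ (N - w₀) := by
          gcongr; exact B.mem_filtration.mp a.2
      _ = B.γ ^ N := by rw [← pow_add]; congr 1; omega
  let M : B.filtration (N - w₀) →ₗ[K] LinearMap.ker E' :=
    { toFun := fun a => ⟨⟨g * a, hmul a⟩, by
        ext φ; simp [E', E, hZ φ φ.2]⟩
      map_add' := fun a b => by ext; simp [mul_add]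
      map_smul' := fun c a => by ext; simp }
  have hM : Function.Injective M := by
    rw [injective_iff_map_eq_zero]
    intro a ha
    have h0 : g * (a : A) = 0 := by
      simpa [M] using congrArg (fun x : LinearMap.ker E' => ((x : B.filtration N) : A)) ha
    by_contra hne
    have hne' : (a : A) ≠ 0 := by simpa using hne
    have := congrArg B.val h0
    rw [map_mul, map_zero] at this
    exact mul_ne_zero (B.val_ne_zero hg) (B.val_ne_zero hne') this
  have h1 := LinearMap.finrank_le_finrank_of_injective hM
  rw [B.finrank_filtration] at h1
  have h2 := B.card_indices_le N w₀
  omega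

theorem card_filtration [Fintype K] (n : ℕ) :
    Nat.card (B.filtration n) = Fintype.card K ^ (B.indices n).card := by
  rw [Module.natCard_eq_pow_finrank (K := K), B.finrank_filtration, Nat.card_eq_fintype_card]

/-- By the pigeonhole principle there is a nontrivial relation `∑ (u i) ^ r * e i = 0`. -/
theorem exists_relation [Fintype K] {p a : ℕ} [Fact p.Prime] [CharP A p] {l m : ℕ}
    (h : (B.indices (p ^ a * l + m)).card < (B.indices l).card * (B.indices m).card) :
    ∃ u : B.indices m → A, u ≠ 0 ∧ (∀ i, u i ∈ B.filtration l) ∧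
      ∑ i, u i ^ p ^ a * B.basis i = 0 := by
  classical
  have : Finite (B.filtration l) := Module.finite_of_finite K
  have : Finite (B.filtration (p ^ a * l + m)) := Module.finite_of_finite K
  let δ : (B.indices m → B.filtration l) → B.filtration (p ^ a * l + m) := fun u =>
    ⟨∑ i, (u i : A) ^ p ^ a * B.basis i, Submodule.sum_mem _ fun i _ => by
      rw [B.mem_filtration, map_mul, map_pow, B.val_basis, pow_add, mul_comm (p ^ a) l, pow_mul]
      have h1 := B.mem_filtration.mp (u i).2
      have h2 := pow_le_pow_right₀ B.one_lt.le (B.mem_indices.mp i.2)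
      gcongr⟩
  have hcard : Nat.card (B.filtration (p ^ a * l + m)) <
      Nat.card (B.indices m → B.filtration l) := by
    rw [Nat.card_fun, B.card_filtration, B.card_filtration, ← pow_mul]
    refine Nat.pow_lt_pow_right Fintype.one_lt_card ?_
    rwa [Nat.card_eq_fintype_card, Fintype.card_coe]
  obtain ⟨u, u', hne, heq⟩ : ∃ u u', u ≠ u' ∧ δ u = δ u' := by
    by_contra! hcon
    have hinj : Function.Injective δ := fun x y hxy => by
      by_contra hxy'; exact hcon x y hxy' hxy
    exact absurd (Nat.card_le_card_of_injective δ hinj) (by omega)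
  refine ⟨fun i => (u i : A) - u' i, fun h0 => hne ?_, fun i => sub_mem (u i).2 (u' i).2, ?_⟩
  · ext i
    simpa [sub_eq_zero] using congrFun h0 i
  · simp_rw [sub_pow_char_pow, sub_mul, Finset.sum_sub_distrib]
    exact sub_eq_zero.mpr (congrArg Subtype.val heq)

/-- Stepanov's method in the form given by Bombieri, bounding the number of `K`-points when the
cardinality of `K` is a square. -/
theorem card_points_le [Fintype K] {p a : ℕ} [Fact p.Prime] [CharP K p] [CharP A p]
    (hK : Fintype.card K = (p ^ a) ^ 2) {l m : ℕ} (hl : l < p ^ a)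
    (h : (B.indices (p ^ a * l + m)).card < (B.indices l).card * (B.indices m).card)
    (Z : Finset (A →ₐ[K] K)) : Z.card ≤ l + p ^ a * m := by
  classical
  set r := p ^ a
  obtain ⟨u, hu, hul, hrel⟩ := B.exists_relation h
  have hval : ∀ i, u i ≠ 0 → ∃ t ≤ l, B.val (u i * B.basis i ^ r) =
      B.γ ^ (t + r * B.weight i) := fun i hi => by
    obtain ⟨j, -, hj, -⟩ := B.exists_val_eq hi
    refine ⟨B.weight j, ?_, ?_⟩
    · have := hul i
      rwa [B.mem_filtration, hj, pow_le_pow_iff_right₀ B.one_lt] at this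
    · rw [map_mul, map_pow, hj, B.val_basis, pow_add, mul_comm r, pow_mul]
  set g := ∑ i, u i * B.basis i ^ r
  have hg : g ≠ 0 := by
    obtain ⟨i₁, hi₁⟩ := Function.ne_iff.mp hu
    have hne : (Finset.univ.filter fun i => u i ≠ 0).Nonempty := ⟨i₁, by simpa using hi₁⟩
    obtain ⟨i₀, hi₀, hmax⟩ := Finset.exists_max_image _
      (fun i : B.indices m => B.weight i) hne
    have hi₀' : u i₀ ≠ 0 := by simpa using hi₀
    have hgv : B.val g = B.val (u i₀ * B.basis i₀ ^ r) := by
      have hgs : g = ∑ i ∈ Finset.univ.filter (fun i => u i ≠ 0), u i * B.basis i ^ r := by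
        rw [Finset.sum_filter]
        refine Finset.sum_congr rfl fun i _ => ?_
        split_ifs with hi
        · rfl
        · simp [not_not.mp hi]
      rw [hgs]
      refine Valuation.map_sum_eq_of_lt B.val hi₀ fun i hi => ?_
      obtain ⟨hi, hii⟩ := Finset.mem_sdiff.mp hi
      obtain ⟨t, ht, hti⟩ := hval i (by simpa using hi)
      obtain ⟨t₀, -, hti₀⟩ := hval i₀ hi₀'
      rw [hti, hti₀]
      refine pow_lt_pow_right₀ B.one_lt ?_
      have hlt : B.weight i < B.weight i₀ := lt_of_le_of_ne (hmax i hi) fun h => hii (by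
        simpa using Subtype.ext (B.inj h))
      have := Nat.mul_le_mul_left r (Nat.succ_le_of_lt hlt)
      rw [Nat.mul_succ] at this
      omega
    intro h0
    obtain ⟨t, -, ht⟩ := hval i₀ hi₀'
    rw [h0, map_zero, ht] at hgv
    exact pow_ne_zero _ B.γ_pos.ne' hgv.symm
  refine B.card_zeros_le hg ?_ Z fun φ _ => ?_
  · refine B.val.map_sum_le fun i _ => ?_
    rcases eq_or_ne (u i) 0 with hi | hi
    · simp [hi]
    · obtain ⟨t, ht, hti⟩ := hval i hi
      rw [hti]
      exact pow_le_pow_right₀ B.one_lt.le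
        (add_le_add ht (Nat.mul_le_mul_left r (B.mem_indices.mp i.2)))
  · have hr : r ≠ 0 := by omega
    rw [← pow_eq_zero_iff hr, map_sum, sum_pow_char_pow]
    have := congrArg φ hrel
    rw [map_sum, map_zero] at this
    rw [← this]
    refine Finset.sum_congr rfl fun i _ => ?_
    rw [map_mul, map_mul, map_pow, map_pow, mul_pow, ← pow_mul, ← sq, ← hK, FiniteField.pow_card]

theorem card_points_le_of_gaps [Fintype K] {p a G : ℕ} [Fact p.Prime] [CharP K p] [CharP A p]
    (hK : Fintype.card K = (p ^ a) ^ 2) (hG : ∀ n, n + 1 ≤ (B.indices n).card + G)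
    (hr : G ^ 2 + 3 * G + 1 < p ^ a) (Z : Finset (A →ₐ[K] K)) :
    Z.card ≤ (p ^ a) ^ 2 + (2 * G + 1) * p ^ a := by
  set r := p ^ a
  have h := B.card_points_le hK (l := r - 1) (m := r + 2 * G) (by omega) ?_ Z
  · refine h.trans ?_
    have : r - 1 ≤ r := Nat.sub_le _ _
    change r - 1 + r * (r + 2 * G) ≤ _
    nlinarith
  · have h1 := B.card_indices_le_succ (r * (r - 1) + (r + 2 * G))
    have h2 := hG (r - 1)
    have h3 := hG (r + 2 * G)
    obtain ⟨s, hs⟩ : ∃ s, r = s + 1 + G := ⟨r - 1 - G, by have := sq_nonneg G; omega⟩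
    have h4 : s + 1 ≤ (B.indices (r - 1)).card := by omega
    have h5 : r + G + 1 ≤ (B.indices (r + 2 * G)).card := by omega
    have h6 := Nat.mul_le_mul h4 h5
    have h7 : r * (r - 1) = r * (s + G) := by congr 1; omega
    rw [h7] at h1 ⊢
    refine lt_of_le_of_lt h1 (lt_of_lt_of_le ?_ h6)
    rw [hs] at hr ⊢
    nlinarith

end WeightedBasis

end WeightFiltration

section ArtinSchreier

universe u

open Polynomial

/-- A field extension of `K`, with an element `y` transcendental over `K`, has a valuation that is
trivial on `K` and has a pole at `y`. -/
theorem exists_valuation_one_lt {K L : Type*} [Field K] [Field L] [Algebra K L] {y : L}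
    (hy : Transcendental K y) :
    ∃ V : ValuationSubring L, (∀ c : K, c ≠ 0 → V.valuation (algebraMap K L c) = 1) ∧
      1 < V.valuation y := by
  have hy0 : y ≠ 0 := fun h => hy (h ▸ isAlgebraic_zero)
  set R : Subring L := (Polynomial.aeval (R := K) y⁻¹).range.toSubring
  have hmem : y⁻¹ ∈ R := ⟨X, by simp⟩
  obtain ⟨V, hRV, hV⟩ := Ideal.image_subset_nonunits_valuationSubring
    (Ideal.span {(⟨y⁻¹, hmem⟩ : R)}) (by
      rw [Ne, Ideal.span_singleton_eq_top]
      intro hu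
      obtain ⟨⟨b, ⟨g, hg⟩⟩, hb⟩ := hu.exists_right_inv
      have h1 : y⁻¹ * b = 1 := congrArg Subtype.val hb
      have h2 : Polynomial.aeval y⁻¹ (X * g - 1 : K[X]) = 0 := by
        have h3 : Polynomial.aeval y⁻¹ g = b := hg
        simp [h3, h1]
      have h3 : (X * g - 1 : K[X]) ≠ 0 := fun h => by
        simpa using congrArg (Polynomial.eval 0) h
      exact hy (IsAlgebraic.inv_iff.mp ⟨_, h3, h2⟩))
  have hle : ∀ c : K, V.valuation (algebraMap K L c) ≤ 1 := fun c =>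
    (V.valuation_le_one_iff _).mpr (hRV ⟨C c, by simp⟩)
  refine ⟨V, fun c hc => le_antisymm (hle c) ?_, ?_⟩
  · have h := hle c⁻¹
    rw [map_inv₀, map_inv₀] at h
    have h0 : 0 < V.valuation (algebraMap K L c) := by
      rw [Valuation.pos_iff]; simpa using hc
    exact (inv_le_one₀ h0).mp h
  · have h : V.valuation y⁻¹ < 1 :=
      V.mem_nonunits_iff.mp (hV ⟨_, Ideal.subset_span rfl, rfl⟩)
    rw [map_inv₀] at h
    exact (inv_lt_one₀ (by rw [Valuation.pos_iff]; exact hy0)).mp h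

theorem Valuation.map_aeval_eq_pow {K L Γ₀ : Type*} [Field K] [Field L] [Algebra K L]
    [LinearOrderedCommGroupWithZero Γ₀] (v : Valuation L Γ₀)
    (hv : ∀ c : K, c ≠ 0 → v (algebraMap K L c) = 1) {y : L} (hy : 1 < v y)
    {H : K[X]} (hH : H ≠ 0) : v (aeval y H) = v y ^ H.natDegree := by
  classical
  have hlead : v (H.coeff H.natDegree • y ^ H.natDegree) = v y ^ H.natDegree := by
    rw [Algebra.smul_def, map_mul, map_pow, hv _ (by simpa using hH), one_mul]
  rw [aeval_eq_sum_range, Valuation.map_sum_eq_of_lt v (j := H.natDegree) (by simp), hlead]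
  intro i hi
  rw [hlead]
  simp only [Finset.mem_sdiff, Finset.mem_range, Finset.mem_singleton] at hi
  have hlt : v y ^ i < v y ^ H.natDegree := pow_lt_pow_right₀ hy (by omega)
  rcases eq_or_ne (H.coeff i) 0 with h0 | h0
  · rw [h0, zero_smul, map_zero]
    exact zero_le.trans_lt hlt
  · rwa [Algebra.smul_def, map_mul, map_pow, hv _ h0, one_mul]

/-- A pole of `z ^ p - z` of the form `y ^ D` with `D` prime to `p`: the values of `y` and `z` are
powers of a common element. -/
theorem Valuation.exists_pow_eq_of_artinSchreier {L Γ₀ : Type*} [Field L]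
    [LinearOrderedCommGroupWithZero Γ₀] (v : Valuation L Γ₀) {y z : L} {p D : ℕ} (hp : 1 < p)
    (hD : D ≠ 0) (hcop : D.Coprime p) (hy : 1 < v y) (hz : v (z ^ p - z) = v y ^ D) :
    ∃ γ : Γ₀, 1 < γ ∧ v y = γ ^ p ∧ v z = γ ^ D := by
  have hyD : 1 < v y ^ D := one_lt_pow₀ hy hD
  have hz1 : 1 < v z := by
    by_contra! h
    have h1 : v (z ^ p - z) ≤ 1 := v.map_sub_le (by rw [map_pow]; exact pow_le_one₀ zero_le h) h
    exact absurd (hz ▸ h1) (not_le.mpr hyD)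
  have hzp : v z ^ p = v y ^ D := by
    rw [← hz, ← map_pow, Valuation.map_sub_eq_of_lt_left]
    rw [map_pow]
    simpa using pow_lt_pow_right₀ hz1 hp
  have hy0 : v y ≠ 0 := (zero_lt_one.trans hy).ne'
  have hz0 : v z ≠ 0 := (zero_lt_one.trans hz1).ne'
  have hzp' : v z ^ (p : ℤ) = v y ^ (D : ℤ) := by simpa using hzp
  have hbez : (D : ℤ) * D.gcdA p + p * D.gcdB p = 1 := by
    rw [← Nat.gcd_eq_gcd_ab, hcop]; rfl
  set s := D.gcdA p
  set t := D.gcdB p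
  have hγp : (v z ^ s * v y ^ t) ^ p = v y := by
    rw [← zpow_natCast, mul_zpow, ← zpow_mul, mul_comm s, zpow_mul, hzp', ← zpow_mul, ← zpow_mul,
      ← zpow_add₀ hy0, mul_comm t, hbez, zpow_one]
  refine ⟨v z ^ s * v y ^ t, ?_, hγp.symm, ?_⟩
  · by_contra! h
    exact absurd (hγp ▸ pow_le_one₀ zero_le h) (not_le.mpr hy)
  · rw [← zpow_natCast, mul_zpow, ← zpow_mul, ← zpow_mul, mul_comm t, zpow_mul (v y), ← hzp',
      ← zpow_mul, ← zpow_add₀ hz0, mul_comm s, hbez, zpow_one]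

/-- The polynomial in `Z` over `K[Y]` defining the curve `Z ^ p - Z = H(Y)`. -/
noncomputable def artinSchreierPoly {K : Type*} [Field K] (p : ℕ) (H : K[X]) : K[X][X] :=
  X ^ p - X - C H

variable {K : Type u} [Field K] {p : ℕ} {H : K[X]}

theorem artinSchreierPoly_natDegree_and_monic (hp : 1 < p) :
    (artinSchreierPoly p H).natDegree = p ∧ (artinSchreierPoly p H).Monic := by
  have h1 : (X + C H : K[X][X]).degree < (X ^ p : K[X][X]).degree := by
    rw [degree_X_add_C, degree_X_pow]
    exact_mod_cast hp
  rw [artinSchreierPoly, sub_sub]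
  refine ⟨?_, (monic_X_pow p).sub_of_left h1⟩
  rw [natDegree_sub_eq_left_of_natDegree_lt (natDegree_lt_natDegree (X_add_C_ne_zero H) h1),
    natDegree_X_pow]

/-- The coordinate ring of the curve `Z ^ p - Z = H(Y)`, with the valuation at infinity. -/
theorem exists_weightedBasis (hp : 1 < p) (hD : H.natDegree ≠ 0) (hcop : H.natDegree.Coprime p) :
    ∃ (Γ₀ : Type u) (_ : LinearOrderedCommGroupWithZero Γ₀)
      (B : WeightedBasis K (AdjoinRoot (artinSchreierPoly p H)) (ℕ × Fin p) Γ₀),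
      ∀ i, B.weight i = p * i.1 + H.natDegree * i.2 := by
  have hH : H ≠ 0 := fun h => hD (by simp [h])
  let L := AlgebraicClosure (FractionRing K[X])
  have hinj : Function.Injective (algebraMap K[X] L) := by
    rw [IsScalarTower.algebraMap_eq K[X] (FractionRing K[X]) L]
    exact (algebraMap (FractionRing K[X]) L).injective.comp (IsFractionRing.injective _ _)
  obtain ⟨hdeg, hmonic⟩ := artinSchreierPoly_natDegree_and_monic (H := H) hp
  obtain ⟨z, hz⟩ := IsAlgClosed.exists_eval₂_eq_zero_of_injective (algebraMap K[X] L) hinj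
    (artinSchreierPoly p H) (by rw [degree_eq_natDegree hmonic.ne_zero, hdeg]; norm_cast; omega)
  set y : L := algebraMap K[X] L X
  have haeval : ∀ g : K[X], aeval y g = algebraMap K[X] L g := fun g => by
    rw [aeval_algebraMap_apply, aeval_X_left_apply]
  have hy : Transcendental K y := by
    rw [transcendental_iff]
    intro g hg
    rw [haeval] at hg
    exact (map_eq_zero_iff _ hinj).mp hg
  obtain ⟨V, hVc, hVy⟩ := exists_valuation_one_lt hy
  have hz' : z ^ p - z = aeval y H := by
    rw [haeval]
    simpa [artinSchreierPoly, sub_eq_zero] using hz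
  obtain ⟨γ, hγ, hyγ, hzγ⟩ := V.valuation.exists_pow_eq_of_artinSchreier hp hD hcop hVy
    (by rw [hz', V.valuation.map_aeval_eq_pow hVc hVy hH])
  let φ : AdjoinRoot (artinSchreierPoly p H) →+* L := AdjoinRoot.lift (algebraMap K[X] L) z hz
  refine ⟨_, inferInstance,
    { basis := ((Polynomial.basisMonomials K).smulTower
        (AdjoinRoot.powerBasis' hmonic).basis).reindex
          (Equiv.prodCongr (Equiv.refl ℕ) (finCongr hdeg))
      val := V.valuation.comap φ
      γ := γ
      weight := fun i => p * i.1 + H.natDegree * i.2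
      one_lt := hγ
      inj := ?_
      val_basis := ?_
      val_const := ?_ }, fun i => rfl⟩
  · rintro ⟨i, j⟩ ⟨i', j'⟩ h
    have h1 : H.natDegree * j ≡ H.natDegree * j' [MOD p] := by
      have := congrArg (· % p) h
      simpa [Nat.ModEq] using this
    have h2 : (j : ℕ) = j' :=
      (Nat.ModEq.cancel_left_of_coprime (Nat.coprime_comm.mp hcop) h1).eq_of_lt_of_lt j.2 j'.2
    simp only [h2, Nat.add_right_cancel_iff] at h
    rw [Prod.mk.injEq]
    exact ⟨Nat.eq_of_mul_eq_mul_left (by omega) h, Fin.ext h2⟩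
  · rintro ⟨i, j⟩
    simp [φ, Algebra.smul_def, AdjoinRoot.algebraMap_eq, ← X_pow_eq_monomial, hzγ, ← hyγ, y,
      pow_add, pow_mul]
    exact Or.inl rfl
  · intro c hc
    rw [Valuation.comap_apply, IsScalarTower.algebraMap_apply K K[X] (AdjoinRoot _),
      AdjoinRoot.algebraMap_eq, AdjoinRoot.lift_of, ← IsScalarTower.algebraMap_apply, hVc c hc]

theorem card_indices_add_gaps (hp : 1 < p) (hcop : H.natDegree.Coprime p) {Γ₀ : Type*}
    [LinearOrderedCommGroupWithZero Γ₀]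
    (B : WeightedBasis K (AdjoinRoot (artinSchreierPoly p H)) (ℕ × Fin p) Γ₀)
    (hB : ∀ i, B.weight i = p * i.1 + H.natDegree * i.2) (n : ℕ) :
    n + 1 ≤ (B.indices n).card + (p - 1) * H.natDegree := by
  classical
  set D := H.natDegree
  have hsub : Finset.Icc ((p - 1) * D) n ⊆ (B.indices n).image B.weight := by
    intro N hN
    obtain ⟨hN1, hN2⟩ := Finset.mem_Icc.mp hN
    obtain ⟨j, hjp, hj⟩ : ∃ j < p, D * j ≡ N [MOD p] := by
      obtain ⟨m, -, hm⟩ := Nat.exists_mul_mod_eq_one_of_coprime hcop hp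
      refine ⟨(m * N) % p, Nat.mod_lt _ (by omega), ?_⟩
      calc D * (m * N % p) ≡ D * (m * N) [MOD p] := (Nat.mod_modEq _ _).mul_left _
        _ = (D * m) * N := by ring
        _ ≡ 1 * N [MOD p] := Nat.ModEq.mul_right _ (by rw [Nat.ModEq, hm, Nat.mod_eq_of_lt hp])
        _ = N := one_mul N
    have hle : D * j ≤ N := le_trans (by rw [mul_comm]; gcongr; omega) hN1
    obtain ⟨i, hi⟩ := (Nat.modEq_iff_dvd' hle).mp hj
    have hw : B.weight (i, ⟨j, hjp⟩) = N := by rw [hB]; simp only; omega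
    exact Finset.mem_image.mpr ⟨(i, ⟨j, hjp⟩), by simp [hw, hN2], hw⟩
  have h1 := (Finset.card_le_card hsub).trans Finset.card_image_le
  rw [Nat.card_Icc] at h1
  omega

/-- Upper bound for the number of points on an Artin-Schreier curve. -/
theorem card_artinSchreier_points_le [Fintype K] [Fact p.Prime] [CharP K p] {a : ℕ}
    (hK : Fintype.card K = (p ^ a) ^ 2) (hD : H.natDegree ≠ 0) (hcop : H.natDegree.Coprime p)
    {G : ℕ} (hG : G = (p - 1) * H.natDegree) (hr : G ^ 2 + 3 * G + 1 < p ^ a)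
    (Z : Finset (K × K)) (hZ : ∀ w ∈ Z, w.2 ^ p - w.2 = H.eval w.1) :
    Z.card ≤ (p ^ a) ^ 2 + (2 * G + 1) * p ^ a := by
  classical
  have hp : 1 < p := (Fact.out : p.Prime).one_lt
  obtain ⟨Γ₀, _, B, hB⟩ := exists_weightedBasis (H := H) hp hD hcop
  have : Nontrivial (AdjoinRoot (artinSchreierPoly p H)) :=
    ⟨_, _, B.basis.ne_zero (0, ⟨0, by omega⟩)⟩
  have : CharP (AdjoinRoot (artinSchreierPoly p H)) p :=
    charP_of_injective_algebraMap (algebraMap K _).injective p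
  have hroot : ∀ w : Z, (artinSchreierPoly p H).eval₂
      ((Polynomial.aeval (w : K × K).1 : K[X] →ₐ[K] K) : K[X] →+* K) (w : K × K).2 = 0 :=
    fun w => by
    simp [artinSchreierPoly, hZ w w.2]
  let ev : Z → (AdjoinRoot (artinSchreierPoly p H) →ₐ[K] K) := fun w =>
    AdjoinRoot.liftAlgHom _ (Polynomial.aeval (w : K × K).1) (w : K × K).2 (hroot w)
  have hev : Function.Injective ev := fun w w' h => by
    have h1 : ev w (AdjoinRoot.of _ X) = ev w' (AdjoinRoot.of _ X) := by rw [h]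
    have h2 : ev w (AdjoinRoot.root _) = ev w' (AdjoinRoot.root _) := by rw [h]
    simp only [ev, AdjoinRoot.liftAlgHom_of, AdjoinRoot.liftAlgHom_root, aeval_X] at h1 h2
    exact Subtype.ext (Prod.ext h1 h2)
  have := B.card_points_le_of_gaps hK (hG ▸ card_indices_add_gaps hp hcop B hB) hr
    (Finset.univ.image ev)
  rwa [Finset.card_image_of_injective _ hev, Finset.card_univ, Fintype.card_coe] at this

end ArtinSchreier

section PointCount

open Polynomial

variable {p : ℕ} [Fact p.Prime] {K : Type*} [Field K] [Fintype K] [Algebra (ZMod p) K]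

theorem Algebra.trace_pow_card_zmod (z : K) :
    Algebra.trace (ZMod p) K (z ^ p) = Algebra.trace (ZMod p) K z := by
  have := Algebra.trace_eq_of_algEquiv
    (FiniteField.frobeniusAlgEquivOfAlgebraic (ZMod p) K) z
  simpa [ZMod.card] using this

/-- The elements of `Kˣ` with prescribed norm and prescribed trace after applying `G`. -/
noncomputable def normTraceFiber (K : Type*) [Field K] [Fintype K] [Algebra (ZMod p) K]
    (G : (ZMod p)[X]) (w : (ZMod p)ˣ × ZMod p) : Finset Kˣ := by
  classical
  exact {x : Kˣ | Units.map (Algebra.norm (ZMod p)) x = w.1 ∧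
    Algebra.trace (ZMod p) K (aeval (x : K) G) = w.2}

theorem mem_normTraceFiber {G : (ZMod p)[X]} {w : (ZMod p)ˣ × ZMod p} {x : Kˣ} :
    x ∈ normTraceFiber K G w ↔ Units.map (Algebra.norm (ZMod p)) x = w.1 ∧
      Algebra.trace (ZMod p) K (aeval (x : K) G) = w.2 := by
  simp [normTraceFiber]

theorem card_norm_fiber_mul [DecidableEq K] (b : (ZMod p)ˣ) :
    (Finset.univ.filter fun x : Kˣ => Units.map (Algebra.norm (ZMod p)) x = b).card * (p - 1) =
      Fintype.card K - 1 := by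
  classical
  have h := Finset.card_eq_sum_card_fiberwise (s := (Finset.univ : Finset Kˣ))
    (t := (Finset.univ : Finset (ZMod p)ˣ)) (f := Units.map (Algebra.norm (ZMod p))) (by simp)
  have hs := FiniteField.unitsMap_norm_surjective (ZMod p) K
  rw [Finset.sum_congr rfl fun c _ =>
    MonoidHom.card_fiber_eq_of_mem_range (Units.map (Algebra.norm (ZMod p)) : Kˣ →* (ZMod p)ˣ)
      (hs c) (hs b)] at h
  rw [Finset.sum_const, Finset.card_univ, Finset.card_univ, Fintype.card_units,
    ZMod.card_units_eq_totient, Nat.totient_prime Fact.out, smul_eq_mul] at h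
  rw [h, mul_comm]

theorem card_trace_fiber_mul (c : ZMod p) :
    (Finset.univ.filter fun x : K => Algebra.trace (ZMod p) K x = c).card * p =
      Fintype.card K := by
  classical
  have h := Finset.card_eq_sum_card_fiberwise (s := (Finset.univ : Finset K))
    (t := (Finset.univ : Finset (ZMod p))) (f := Algebra.trace (ZMod p) K) (by simp)
  have hs := Algebra.trace_surjective (ZMod p) K
  rw [Finset.sum_congr rfl fun b _ =>
    AddMonoidHom.card_fiber_eq_of_mem_range (Algebra.trace (ZMod p) K)
      (hs b) (hs c)] at h
  rw [Finset.sum_const, Finset.card_univ, Finset.card_univ, ZMod.card, smul_eq_mul] at h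
  rw [h, mul_comm]

/-- The number of points of `z ^ p - z = G(β * y ^ (p - 1)) - γ` bounds the size of the sets
`normTraceFiber`. -/
theorem card_normTraceFiber_mul_le {G : (ZMod p)[X]} {M : ℕ}
    (hM : ∀ (β : Kˣ) (γ : K) (Z : Finset (K × K)),
      (∀ w ∈ Z, w.2 ^ p - w.2 = aeval ((β : K) * w.1 ^ (p - 1)) G - γ) → Z.card ≤ M)
    (w : (ZMod p)ˣ × ZMod p) :
    (normTraceFiber K G w).card * (p * (p - 1)) ≤ M := by
  classical
  obtain ⟨b, c⟩ := w
  set Fb := Finset.univ.filter fun x : Kˣ => Units.map (Algebra.norm (ZMod p)) x = b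
  set Fc := Finset.univ.filter fun x : K => Algebra.trace (ZMod p) K x = c
  let Z : Kˣ × K → Finset (K × K) := fun v => Finset.univ.filter fun w =>
    w.2 ^ p - w.2 = aeval ((v.1 : K) * w.1 ^ (p - 1)) G - v.2
  set T : Finset ((Kˣ × K) × (K × K)) :=
    (Fb ×ˢ Fc).sigma Z |>.map (Equiv.sigmaEquivProd _ _).toEmbedding
  have hT : T.card ≤ (Fb.card * Fc.card) * M := by
    rw [Finset.card_map, Finset.card_sigma, ← Finset.card_product, ← smul_eq_mul]
    exact Finset.sum_le_card_nsmul _ _ _ fun v _ => hM v.1 v.2 _ fun w hw => by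
      simpa [Z] using hw
  let f : Kˣ × (Kˣ × K) → (Kˣ × K) × (K × K) := fun t =>
    ((t.1 * (t.2.1 ^ (p - 1))⁻¹, aeval (t.1 : K) G - (t.2.2 ^ p - t.2.2)), ((t.2.1 : K), t.2.2))
  have hf : Function.Injective f := by
    rintro ⟨x, y, z⟩ ⟨x', y', z'⟩ h
    simp only [f, Prod.mk.injEq, Units.val_inj] at h
    obtain ⟨⟨h1, -⟩, h2, h3⟩ := h
    subst h2
    simp_all
  have hpow : ∀ u : (ZMod p)ˣ, u ^ (p - 1) = 1 := fun u => ZMod.units_pow_card_sub_one_eq_one p u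
  have hsub : ((normTraceFiber K G (b, c)) ×ˢ Finset.univ).image f ⊆ T := by
    intro t ht
    obtain ⟨⟨x, y, z⟩, hx, rfl⟩ := Finset.mem_image.mp ht
    obtain ⟨hx1, hx2⟩ := mem_normTraceFiber.mp (Finset.mem_product.mp hx).1
    simp only [T, Finset.mem_map_equiv, Equiv.sigmaEquivProd_symm_apply, Finset.mem_sigma, f,
      Finset.mem_product, Fb, Fc, Z, Finset.mem_filter, Finset.mem_univ, true_and]
    refine ⟨⟨?_, ?_⟩, ?_⟩
    · rw [map_mul, map_inv, map_pow, hpow, hx1, inv_one, mul_one]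
    · rw [map_sub, map_sub, Algebra.trace_pow_card_zmod, sub_self, sub_zero]
      exact hx2
    · simp
  have hcard := Finset.card_le_card hsub
  rw [Finset.card_image_of_injective _ hf, Finset.card_product, Finset.card_univ,
    Fintype.card_prod, Fintype.card_units] at hcard
  have h1 := card_norm_fiber_mul (K := K) b
  have h2 := card_trace_fiber_mul (K := K) c
  have hq : 0 < (Fintype.card K - 1) * Fintype.card K :=
    Nat.mul_pos (Nat.sub_pos_of_lt Fintype.one_lt_card) Fintype.card_pos
  refine Nat.le_of_mul_le_mul_right ?_ hq
  calc (normTraceFiber K G (b, c)).card * (p * (p - 1)) * ((Fintype.card K - 1) * Fintype.card K)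
      = ((normTraceFiber K G (b, c)).card * ((Fintype.card K - 1) * Fintype.card K))
        * (p * (p - 1)) := by ring
    _ ≤ (Fb.card * Fc.card) * M * (p * (p - 1)) := Nat.mul_le_mul_right _ (hcard.trans hT)
    _ = M * ((Fb.card * (p - 1)) * (Fc.card * p)) := by ring
    _ = M * ((Fintype.card K - 1) * Fintype.card K) := by rw [h1, h2]

theorem card_normTraceFiber_le {G : (ZMod p)[X]} (hG0 : G.natDegree ≠ 0) (hGp : G.natDegree < p)
    {a g : ℕ} (hK : Fintype.card K = (p ^ a) ^ 2) (hg : g = (p - 1) * (G.natDegree * (p - 1)))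
    (ha : g ^ 2 + 3 * g + 1 < p ^ a) (w : (ZMod p)ˣ × ZMod p) :
    (normTraceFiber K G w).card * (p * (p - 1)) ≤ (p ^ a) ^ 2 + (2 * g + 1) * p ^ a := by
  have hp : p.Prime := Fact.out
  have hp1 : p - 1 ≠ 0 := by have := hp.one_lt; omega
  have : CharP K p := charP_of_injective_algebraMap (algebraMap (ZMod p) K).injective p
  refine card_normTraceFiber_mul_le (fun β γ Z hZ => ?_) w
  set H : K[X] := (G.map (algebraMap (ZMod p) K)).comp (C (β : K) * X ^ (p - 1)) - C γ
  have hH : H.natDegree = G.natDegree * (p - 1) := by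
    rw [natDegree_sub_C, natDegree_comp, natDegree_map, natDegree_C_mul_X_pow _ _ β.ne_zero]
  refine card_artinSchreier_points_le (H := H) hK ?_ ?_ (by rw [hg, hH]) ha Z fun w hw => ?_
  · rw [hH]; exact mul_ne_zero hG0 hp1
  · rw [hH]
    refine Nat.Coprime.mul_left ?_ ?_
    · exact (Nat.coprime_of_lt_prime hG0 hGp hp).symm
    · exact (Nat.coprime_of_lt_prime hp1 (by omega) hp).symm
  · rw [hZ w hw]
    simp [H, eval_map_algebraMap]

/-- Square-root cancellation, with some constant, in the sums over large extensions. -/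
theorem norm_sum_norm_trace_le {G : (ZMod p)[X]} (hG0 : G.natDegree ≠ 0) (hGp : G.natDegree < p)
    {a g : ℕ} (hK : Fintype.card K = (p ^ a) ^ 2) (hg : g = (p - 1) * (G.natDegree * (p - 1)))
    (ha : g ^ 2 + 3 * g + 1 < p ^ a) (χ : DirichletCharacter ℂ p) {ψ : AddChar (ZMod p) ℂ}
    (hψ : ψ ≠ 1) :
    ‖∑ x : K, χ (Algebra.norm (ZMod p) x) * ψ (Algebra.trace (ZMod p) K (aeval x G))‖ ≤
      (2 * g + 2) * p ^ a := by
  classical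
  have hp : p.Prime := Fact.out
  have hp2 : (2 : ℝ) ≤ p := by exact_mod_cast hp.two_le
  set F : (ZMod p)ˣ × ZMod p → ℂ := fun w => χ w.1 * ψ w.2
  set N : (ZMod p)ˣ × ZMod p → ℝ := fun w => (normTraceFiber K G w).card
  set M : ℝ := ((p ^ a) ^ 2 + (2 * g + 1) * p ^ a) / (p * (p - 1))
  have hNM : ∀ w, N w ≤ M := fun w => by
    have h := card_normTraceFiber_le hG0 hGp hK hg ha w
    rw [le_div_iff₀ (by nlinarith)]
    have h' : ((normTraceFiber K G w).card : ℝ) * (p * ((p - 1 : ℕ) : ℝ)) ≤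
      (p ^ a) ^ 2 + (2 * g + 1) * p ^ a := by exact_mod_cast h
    rwa [Nat.cast_pred hp.pos] at h'
  let τ : Kˣ → (ZMod p)ˣ × ZMod p := fun x =>
    (Units.map (Algebra.norm (ZMod p)) x, Algebra.trace (ZMod p) K (aeval (x : K) G))
  have hfib : ∀ w, (Finset.univ.filter fun x => τ x = w) = normTraceFiber K G w := fun w => by
    ext x
    simp [mem_normTraceFiber, τ, Prod.ext_iff]
  have hsum : ∑ x : K, χ (Algebra.norm (ZMod p) x) * ψ (Algebra.trace (ZMod p) K (aeval x G)) =
      ∑ w, (N w : ℂ) * F w := by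
    have h0 : ∀ x : K, x ∉ Set.range (Units.val : Kˣ → K) →
        χ (Algebra.norm (ZMod p) x) * ψ (Algebra.trace (ZMod p) K (aeval x G)) = 0 := by
      intro x hx
      have : x = 0 := by
        by_contra h
        exact hx ⟨Units.mk0 x h, rfl⟩
      rw [this, Algebra.norm_zero, MulChar.map_zero, zero_mul]
    rw [← Fintype.sum_of_injective (Units.val : Kˣ → K) Units.val_injective
      (fun x => F (τ x)) _ h0 (fun x => rfl),
      ← Finset.sum_fiberwise (s := Finset.univ) (g := τ)]
    refine Finset.sum_congr rfl fun w _ => ?_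
    rw [hfib, Finset.sum_congr rfl (g := fun _ => F w), Finset.sum_const, nsmul_eq_mul]
    · simp [N]
    · intro x hx
      rw [← hfib, Finset.mem_filter] at hx
      rw [hx.2]
  have hF0 : ∑ w, F w = 0 := by
    simp only [F]
    rw [Fintype.sum_prod_type]
    simp_rw [← Finset.mul_sum, AddChar.sum_eq_zero_of_ne_one hψ]
    simp
  have hF1 : ∀ w, ‖F w‖ ≤ 1 := fun w => by
    rw [norm_mul, AddChar.norm_apply, mul_one]
    exact χ.norm_le_one _
  have hNsum : ∑ w, N w = (p ^ a : ℝ) ^ 2 - 1 := by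
    have h := Finset.card_eq_sum_card_fiberwise (s := (Finset.univ : Finset Kˣ))
      (t := Finset.univ) (f := τ) (by simp)
    simp_rw [hfib] at h
    rw [Finset.card_univ, Fintype.card_units, hK] at h
    simp only [N]
    rw [← Nat.cast_sum, ← h, Nat.cast_pred (by have := hp.pos; positivity)]
    push_cast
    ring
  have hcard : (Fintype.card ((ZMod p)ˣ × ZMod p) : ℝ) = p * (p - 1) := by
    rw [Fintype.card_prod, ZMod.card_units_eq_totient, Nat.totient_prime hp, ZMod.card,
      Nat.cast_mul, Nat.cast_pred hp.pos, mul_comm]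
  calc ‖∑ x : K, χ (Algebra.norm (ZMod p) x) * ψ (Algebra.trace (ZMod p) K (aeval x G))‖
      = ‖∑ w, ((N w - M : ℝ) : ℂ) * F w‖ := by
        rw [hsum]
        push_cast
        simp_rw [sub_mul, Finset.sum_sub_distrib, ← Finset.mul_sum, hF0]
        simp
    _ ≤ ∑ w, (M - N w) := by
        refine norm_sum_le_of_le _ fun w _ => ?_
        rw [norm_mul, Complex.norm_real, Real.norm_eq_abs, abs_sub_comm,
          abs_of_nonneg (sub_nonneg.mpr (hNM w))]
        exact mul_le_of_le_one_right (sub_nonneg.mpr (hNM w)) (hF1 w)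
    _ = (2 * g + 1) * p ^ a + 1 := by
        rw [Finset.sum_sub_distrib, hNsum, Finset.sum_const, Finset.card_univ, nsmul_eq_mul, hcard]
        simp only [M]
        rw [mul_div_cancel₀ _ (by nlinarith)]
        ring
    _ ≤ (2 * g + 2) * p ^ a := by
        have : (1 : ℝ) ≤ (p : ℝ) ^ a := one_le_pow₀ (by linarith)
        linarith

end PointCount

section PolynomialWeight

open Polynomial IntermediateField

variable {k : Type*} [Field k]

/-- The completely multiplicative function on monic polynomials attached to a multiplicative
character, an additive character of the algebraic closure, and a polynomial `G`. -/
noncomputable def polyWeight (χ : MulChar k ℂ) (Ψ : AddChar (AlgebraicClosure k) ℂ) (G f : k[X]) :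
    ℂ :=
  χ ((-1) ^ f.natDegree * f.coeff 0) *
    Ψ ((f.aroots (AlgebraicClosure k)).map fun α => aeval α G).sum

variable {χ : MulChar k ℂ} {Ψ : AddChar (AlgebraicClosure k) ℂ} {G : k[X]}

theorem polyWeight_one : polyWeight χ Ψ G 1 = 1 := by
  simp [polyWeight]

theorem polyWeight_mul {f g : k[X]} (hf : f ≠ 0) (hg : g ≠ 0) :
    polyWeight χ Ψ G (f * g) = polyWeight χ Ψ G f * polyWeight χ Ψ G g := by
  have h : (-1 : k) ^ (f.natDegree + g.natDegree) * (f.coeff 0 * g.coeff 0) =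
      ((-1) ^ f.natDegree * f.coeff 0) * ((-1) ^ g.natDegree * g.coeff 0) := by ring
  rw [polyWeight, polyWeight, polyWeight, natDegree_mul hf hg, mul_coeff_zero, h, map_mul,
    aroots_mul (mul_ne_zero hf hg), Multiset.map_add, Multiset.sum_add, AddChar.map_add_eq_mul]
  ring

/-- The product of the conjugates `X - σ x`, over all embeddings `σ` of `L` over `k`. -/
noncomputable def conjPoly (k : Type*) [Field k] {L : Type*} [Field L] [Algebra k L] (x : L) :
    k[X] :=
  minpoly k x ^ Module.finrank k⟮x⟯ L

variable {L : Type*} [Field L] [Algebra k L] [FiniteDimensional k L]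

theorem conjPoly_monic (x : L) : (conjPoly k x).Monic :=
  (minpoly.monic (IsIntegral.of_finite k x)).pow _

theorem natDegree_conjPoly (x : L) : (conjPoly k x).natDegree = Module.finrank k L := by
  rw [conjPoly, natDegree_pow, ← adjoin.finrank (IsIntegral.of_finite k x), mul_comm,
    Module.finrank_mul_finrank]

theorem sum_embeddings_eq_finrank_nsmul [Algebra.IsSeparable k L] (x : L)
    (h : AlgebraicClosure k → AlgebraicClosure k) :
    ∑ σ : L →ₐ[k] AlgebraicClosure k, h (σ x) =
      Module.finrank k⟮x⟯ L • (((minpoly k x).aroots (AlgebraicClosure k)).map h).sum := by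
  classical
  have hx : IsIntegral k x := IsIntegral.of_finite k x
  have : Algebra.IsSeparable k⟮x⟯ L := Algebra.isSeparable_tower_top_of_isSeparable k k⟮x⟯ L
  let pb := adjoin.powerBasis hx
  let : Fintype (k⟮x⟯ →ₐ[k] AlgebraicClosure k) := PowerBasis.AlgHom.fintype pb
  have hmin : minpoly k pb.gen = minpoly k x := by
    rw [adjoin.powerBasis_gen, minpoly_gen]
  have h1 : ∑ σ : k⟮x⟯ →ₐ[k] AlgebraicClosure k, h (σ pb.gen) =
      (((minpoly k x).aroots (AlgebraicClosure k)).map h).sum := by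
    rw [← hmin, Fintype.sum_equiv pb.liftEquiv' (fun σ => h (σ pb.gen)) (fun y => h y)
      (fun σ => by rw [PowerBasis.liftEquiv'_apply_coe]),
      Finset.sum_mem_multiset _ _ h (fun _ => rfl), Finset.sum_eq_multiset_sum,
      Multiset.toFinset_val, Multiset.dedup_eq_self.mpr]
    rw [hmin]
    exact nodup_roots (Polynomial.Separable.map (Algebra.IsSeparable.isSeparable k x))
  rw [← h1, Fintype.sum_equiv algHomEquivSigma
    (fun σ : L →ₐ[k] AlgebraicClosure k => h (σ x)) (fun σ => h (σ.1 pb.gen)),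
    ← Finset.univ_sigma_univ, Finset.sum_sigma, ← Finset.sum_nsmul]
  · refine Finset.sum_congr rfl fun σ _ => ?_
    let : Algebra k⟮x⟯ (AlgebraicClosure k) := σ.toRingHom.toAlgebra
    simp_rw [Finset.sum_const, Finset.card_univ, ← AlgHom.card k⟮x⟯ L (AlgebraicClosure k)]
  · intro σ
    simp [algHomEquivSigma, pb, AlgHom.domRestrict]

theorem polyWeight_conjPoly [Algebra.IsSeparable k L] (x : L) :
    polyWeight χ Ψ G (conjPoly k x) =
      χ (Algebra.norm k x) *
        Ψ (algebraMap k (AlgebraicClosure k) (Algebra.trace k L (aeval x G))) := by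
  have hN : (-1) ^ (conjPoly k x).natDegree * (conjPoly k x).coeff 0 = Algebra.norm k x := by
    apply (algebraMap k (AlgebraicClosure k)).injective
    rw [Algebra.norm_eq_prod_roots _ (IsAlgClosed.splits _), map_mul, ← coeff_map,
      (IsAlgClosed.splits _).coeff_zero_eq_prod_roots_of_monic ((conjPoly_monic x).map _),
      natDegree_map, map_pow, map_neg, map_one, ← mul_assoc, ← pow_add, ← two_mul, pow_mul,
      neg_one_sq, one_pow, one_mul, ← aroots_def, conjPoly, aroots_pow, Multiset.prod_nsmul]
  rw [polyWeight, hN, trace_eq_sum_embeddings (AlgebraicClosure k), conjPoly, aroots_pow,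
    Multiset.map_nsmul, Multiset.sum_nsmul, ← sum_embeddings_eq_finrank_nsmul]
  simp only [aeval_algHom_apply]

end PolynomialWeight

section LFunctionCoefficients

open Polynomial IntermediateField UniqueFactorizationMonoid

noncomputable instance GaloisField.instFintype (p : ℕ) [Fact p.Prime] (n : ℕ) :
    Fintype (GaloisField p n) :=
  Fintype.ofFinite _

theorem Polynomial.finite_monic_natDegree_eq (k : Type*) [Field k] [Finite k] (n : ℕ) :
    {f : k[X] | f.Monic ∧ f.natDegree = n}.Finite := by
  refine Set.Finite.of_finite_image (f := fun f (i : Fin (n + 1)) => f.coeff i) (Set.toFinite _) ?_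
  intro f hf g hg h
  ext i
  rcases Nat.lt_or_ge n i with hi | hi
  · rw [coeff_eq_zero_of_natDegree_lt (hf.2.trans_lt hi),
      coeff_eq_zero_of_natDegree_lt (hg.2.trans_lt hi)]
  · exact congrFun h ⟨i, Nat.lt_succ_of_le hi⟩

/-- The monic polynomials of degree `n` over a finite field. -/
noncomputable def monicsOfDegree (k : Type*) [Field k] [Finite k] (n : ℕ) : Finset k[X] :=
  (Polynomial.finite_monic_natDegree_eq k n).toFinset

theorem mem_monicsOfDegree {k : Type*} [Field k] [Finite k] {n : ℕ} {f : k[X]} :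
    f ∈ monicsOfDegree k n ↔ f.Monic ∧ f.natDegree = n := by
  simp [monicsOfDegree]

variable {p : ℕ} [Fact p.Prime]

theorem card_minpoly_eq {L : Type*} [Field L] [Algebra (ZMod p) L] [Fintype L] {P : (ZMod p)[X]}
    (hP : Irreducible P) (hPm : P.Monic) [DecidableEq (ZMod p)[X]] :
    (Finset.univ.filter fun x : L => minpoly (ZMod p) x = P).card =
      if P.natDegree ∣ Module.finrank (ZMod p) L then P.natDegree else 0 := by
  classical
  split_ifs with h
  · have hdvd : P ∣ X ^ Nat.card L - X := by
      rw [Module.natCard_eq_pow_finrank (K := ZMod p)]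
      exact hP.natDegree_dvd_iff_dvd_X_pow_card_pow_sub_X.mp h
    have hsplit : (P.map (algebraMap (ZMod p) L)).Splits :=
      (FiniteField.splits_X_pow_nat_card_sub_X p).of_dvd
        (map_ne_zero (FiniteField.X_pow_card_sub_X_ne_zero _ Finite.one_lt_card))
        (Polynomial.map_dvd _ hdvd)
    rw [← card_rootSet_eq_natDegree (PerfectField.separable_of_irreducible hP) hsplit,
      ← Set.toFinset_card]
    congr 1
    ext x
    simp only [Finset.mem_filter, Finset.mem_univ, true_and, Set.mem_toFinset, mem_rootSet]
    constructor
    · rintro rfl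
      exact ⟨hP.ne_zero, minpoly.aeval _ _⟩
    · exact fun hx => (minpoly.eq_of_irreducible_of_monic hP hx.2 hPm).symm
  · rw [Finset.card_eq_zero, Finset.filter_eq_empty_iff]
    rintro x - rfl
    exact h (minpoly.degree_dvd (IsIntegral.of_finite _ x))

theorem conjPoly_eq_pow {j : ℕ} (hj : j ≠ 0) (x : GaloisField p j) :
    conjPoly (ZMod p) x = minpoly (ZMod p) x ^ (j / (minpoly (ZMod p) x).natDegree) := by
  have hx : IsIntegral (ZMod p) x := IsIntegral.of_finite _ x
  have h := Module.finrank_mul_finrank (ZMod p) (ZMod p)⟮x⟯ (GaloisField p j)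
  rw [conjPoly, ← adjoin.finrank hx]
  congr 1
  rw [GaloisField.finrank p hj] at h
  rw [eq_comm]
  exact Nat.div_eq_of_eq_mul_right Module.finrank_pos h.symm

theorem card_conjPoly_dvd {j : ℕ} (hj : j ≠ 0) {f : (ZMod p)[X]} (hf : f.Monic)
    [DecidableEq (ZMod p)[X]] [DecidablePred fun x : GaloisField p j => conjPoly (ZMod p) x ∣ f] :
    (Finset.univ.filter fun x : GaloisField p j => conjPoly (ZMod p) x ∣ f).card =
      ∑ P ∈ (normalizedFactors f).toFinset,
        if P.natDegree ∣ j ∧ j / P.natDegree ≤ (normalizedFactors f).count P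
          then P.natDegree else 0 := by
  have hmono : ∀ P ∈ normalizedFactors f, P.Monic := fun P hP => by
    rw [← normalize_normalized_factor P hP]
    exact monic_normalize (irreducible_of_normalized_factor P hP).ne_zero
  have hdvd : ∀ x : GaloisField p j, conjPoly (ZMod p) x ∣ f ↔
      j / (minpoly (ZMod p) x).natDegree ≤ (normalizedFactors f).count (minpoly (ZMod p) x) := by
    intro x
    have hx : IsIntegral (ZMod p) x := IsIntegral.of_finite _ x
    rw [conjPoly_eq_pow hj, pow_dvd_iff_le_emultiplicity,
      emultiplicity_eq_count_normalizedFactors (minpoly.irreducible hx) hf.ne_zero,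
      (minpoly.monic hx).normalize_eq_self, Nat.cast_le]
  rw [Finset.card_eq_sum_card_fiberwise (f := minpoly (ZMod p))
    (t := (normalizedFactors f).toFinset)]
  · refine Finset.sum_congr rfl fun P hP => ?_
    rw [Multiset.mem_toFinset] at hP
    have hPi := irreducible_of_normalized_factor P hP
    rw [Finset.filter_filter]
    by_cases hc : j / P.natDegree ≤ (normalizedFactors f).count P
    · simp only [hc, and_true]
      have h := card_minpoly_eq (L := GaloisField p j) hPi (hmono P hP)
      rw [GaloisField.finrank p hj] at h
      rw [← h]
      congr 1
      refine Finset.filter_congr fun x _ => ?_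
      rw [hdvd]
      constructor
      · exact fun h => h.2
      · rintro rfl
        exact ⟨hc, rfl⟩
    · simp only [hc, and_false, if_false]
      rw [Finset.card_eq_zero, Finset.filter_eq_empty_iff]
      rintro x - ⟨h, rfl⟩
      exact hc ((hdvd x).mp h)
  · intro x hx
    have hx' : IsIntegral (ZMod p) x := IsIntegral.of_finite _ x
    simp only [Finset.coe_filter, Finset.mem_univ, true_and, Set.mem_ofPred_eq, hdvd] at hx
    rw [Finset.mem_coe, Multiset.mem_toFinset, ← Multiset.count_pos]
    refine lt_of_lt_of_le (Nat.div_pos ?_ (minpoly.natDegree_pos hx')) hx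
    have := minpoly.natDegree_le (A := ZMod p) x
    rwa [GaloisField.finrank p hj] at this

theorem sum_ite_dvd (n e m : ℕ) (he : e ≠ 0) (hm : m * e ≤ n) :
    ∑ j ∈ Finset.Icc 1 n, (if e ∣ j ∧ j / e ≤ m then e else 0) = m * e := by
  rw [← Finset.sum_filter, Finset.sum_const, smul_eq_mul]
  congr 1
  have : (Finset.Icc 1 n).filter (fun j => e ∣ j ∧ j / e ≤ m) =
      (Finset.Icc 1 m).image (fun i => e * i) := by
    ext j
    simp only [Finset.mem_filter, Finset.mem_Icc, Finset.mem_image]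
    constructor
    · rintro ⟨⟨h1, h2⟩, ⟨i, rfl⟩, h3⟩
      rw [Nat.mul_div_cancel_left _ (Nat.pos_of_ne_zero he)] at h3
      exact ⟨i, ⟨Nat.pos_of_ne_zero (by rintro rfl; simp at h1), h3⟩, rfl⟩
    · rintro ⟨i, ⟨h1, h2⟩, rfl⟩
      refine ⟨⟨Nat.mul_pos (Nat.pos_of_ne_zero he) h1, ?_⟩, dvd_mul_right _ _, ?_⟩
      · exact (by nlinarith : e * i ≤ m * e).trans hm
      · rwa [Nat.mul_div_cancel_left _ (Nat.pos_of_ne_zero he)]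
  rw [this, Finset.card_image_of_injective _ fun a b h =>
    Nat.eq_of_mul_eq_mul_left (Nat.pos_of_ne_zero he) h, Nat.card_Icc]
  omega

theorem sum_card_conjPoly_dvd {n : ℕ} {f : (ZMod p)[X]} (hf : f ∈ monicsOfDegree (ZMod p) n)
    [DecidableRel ((· ∣ ·) : (ZMod p)[X] → (ZMod p)[X] → Prop)] :
    ∑ j ∈ Finset.Icc 1 n,
      (Finset.univ.filter fun x : GaloisField p j => conjPoly (ZMod p) x ∣ f).card = n := by
  classical
  obtain ⟨hm, hn⟩ := mem_monicsOfDegree.mp hf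
  have hmono : ∀ P ∈ normalizedFactors f, P.Monic := fun P hP => by
    rw [← normalize_normalized_factor P hP]
    exact monic_normalize (irreducible_of_normalized_factor P hP).ne_zero
  have hdeg : ∑ P ∈ (normalizedFactors f).toFinset,
      (normalizedFactors f).count P * P.natDegree = n := by
    have h := natDegree_multiset_prod_of_monic _ hmono
    rw [prod_normalizedFactors_eq hm.ne_zero, hm.normalize_eq_self, hn,
      Finset.sum_multiset_map_count] at h
    simpa using h.symm
  rw [Finset.sum_congr rfl fun j hj => card_conjPoly_dvd
    (by have := (Finset.mem_Icc.mp hj).1; omega) hm, Finset.sum_comm]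
  conv_rhs => rw [← hdeg]
  refine Finset.sum_congr rfl fun P hP => sum_ite_dvd n _ _ ?_ ?_
  · rw [Multiset.mem_toFinset] at hP
    exact (irreducible_of_normalized_factor P hP).natDegree_pos.ne'
  · rw [← hdeg]
    exact Finset.single_le_sum (f := fun P => (normalizedFactors f).count P * P.natDegree)
      (fun _ _ => Nat.zero_le _) hP

/-- The coefficients of the `L`-function attached to `χ`, `Ψ` and `G`. -/
noncomputable def lCoeff (χ : MulChar (ZMod p) ℂ) (Ψ : AddChar (AlgebraicClosure (ZMod p)) ℂ)
    (G : (ZMod p)[X]) (n : ℕ) : ℂ :=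
  ∑ f ∈ monicsOfDegree (ZMod p) n, polyWeight χ Ψ G f

variable {χ : MulChar (ZMod p) ℂ} {Ψ : AddChar (AlgebraicClosure (ZMod p)) ℂ} {G : (ZMod p)[X]}

theorem lCoeff_zero : lCoeff χ Ψ G 0 = 1 := by
  have : monicsOfDegree (ZMod p) 0 = {1} := by
    ext f
    rw [mem_monicsOfDegree, Finset.mem_singleton]
    constructor
    · rintro ⟨h1, h2⟩
      exact h1.natDegree_eq_zero.mp h2
    · rintro rfl
      exact ⟨monic_one, natDegree_one⟩
  rw [lCoeff, this, Finset.sum_singleton, polyWeight_one]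

theorem mul_lCoeff (n : ℕ) :
    n * lCoeff χ Ψ G n = ∑ j ∈ Finset.Icc 1 n,
      (∑ x : GaloisField p j, polyWeight χ Ψ G (conjPoly (ZMod p) x)) * lCoeff χ Ψ G (n - j) := by
  classical
  have hfib : ∀ j ∈ Finset.Icc 1 n, ∀ x : GaloisField p j,
      polyWeight χ Ψ G (conjPoly (ZMod p) x) * lCoeff χ Ψ G (n - j) =
        ∑ f ∈ monicsOfDegree (ZMod p) n,
          if conjPoly (ZMod p) x ∣ f then polyWeight χ Ψ G f else 0 := by
    intro j hj x
    obtain ⟨h1, h2⟩ := Finset.mem_Icc.mp hj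
    have hc := conjPoly_monic (k := ZMod p) x
    have hcd : (conjPoly (ZMod p) x).natDegree = j := by
      rw [natDegree_conjPoly, GaloisField.finrank p (by omega)]
    rw [← Finset.sum_filter, lCoeff, Finset.mul_sum]
    refine Finset.sum_bij (fun g _ => conjPoly (ZMod p) x * g) ?_ ?_ ?_ ?_
    · intro g hg
      obtain ⟨hg1, hg2⟩ := mem_monicsOfDegree.mp hg
      refine Finset.mem_filter.mpr ⟨mem_monicsOfDegree.mpr ⟨hc.mul hg1, ?_⟩, dvd_mul_right _ _⟩
      rw [hc.natDegree_mul hg1, hcd, hg2]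
      omega
    · intro g _ g' _ h
      exact mul_left_cancel₀ hc.ne_zero h
    · intro f hf
      obtain ⟨hf1, g, rfl⟩ := Finset.mem_filter.mp hf
      obtain ⟨hm, hd⟩ := mem_monicsOfDegree.mp hf1
      have hg := hc.of_mul_monic_left hm
      rw [hc.natDegree_mul hg, hcd] at hd
      exact ⟨g, mem_monicsOfDegree.mpr ⟨hg, by omega⟩, rfl⟩
    · intro g hg
      rw [polyWeight_mul hc.ne_zero (mem_monicsOfDegree.mp hg).1.ne_zero]
  rw [Finset.sum_congr rfl fun j hj => by
    rw [Finset.sum_mul, Finset.sum_congr rfl fun x _ => hfib j hj x, Finset.sum_comm],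
    Finset.sum_comm, lCoeff, Finset.mul_sum]
  refine Finset.sum_congr rfl fun f hf => ?_
  conv_lhs => rw [← sum_card_conjPoly_dvd hf]
  rw [Nat.cast_sum, Finset.sum_mul]
  refine Finset.sum_congr rfl fun j _ => ?_
  rw [← Finset.sum_filter, Finset.sum_const, nsmul_eq_mul]

end LFunctionCoefficients

section Newton

theorem Multiset.esymm_zero_right {R : Type*} [CommSemiring R] (s : Multiset R) :
    s.esymm 0 = 1 := by
  simp [Multiset.esymm]

theorem Multiset.newton {R : Type*} [CommRing R] (s : Multiset R) (k : ℕ) :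
    k * ((-1) ^ k * s.esymm k) +
      ∑ j ∈ Finset.range k, (-1) ^ j * s.esymm j * (s.map (· ^ (k - j))).sum = 0 := by
  obtain ⟨n, f, rfl⟩ : ∃ (n : ℕ) (f : Fin n → R), s = Finset.univ.val.map f := by
    induction s using Quotient.inductionOn with
    | h l => exact ⟨l.length, l.get, by simp [Fin.univ_val_map]⟩
  have h := congrArg (MvPolynomial.aeval f) (MvPolynomial.mul_esymm_eq_sum (Fin n) R k)
  simp only [map_mul, map_natCast, map_sum, map_pow, map_neg, map_one,
    MvPolynomial.aeval_esymm_eq_multiset_esymm, MvPolynomial.psum, MvPolynomial.aeval_X] at h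
  have hs : Finset.filter (fun a : ℕ × ℕ => a.1 < k) (Finset.HasAntidiagonal.antidiagonal k) =
      (Finset.range k).image fun j => (j, k - j) := by
    ext ⟨a, b⟩
    simp only [Finset.mem_filter, Finset.HasAntidiagonal.mem_antidiagonal, Finset.mem_image,
      Finset.mem_range, Prod.mk.injEq]
    constructor
    · exact fun h => ⟨a, h.2, rfl, by omega⟩
    · rintro ⟨j, hj, rfl, rfl⟩
      omega
  rw [hs, Finset.sum_image fun a _ b _ h => (Prod.mk.inj h).1] at h
  have e : (k : R) * ((-1) ^ k * (Finset.univ.val.map f).esymm k) =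
      (-1) ^ k * (k * (Finset.univ.val.map f).esymm k) := by ring
  have e2 : (-1 : R) ^ k * (-1) ^ (k + 1) = -1 := by
    rw [← pow_add, Odd.neg_one_pow ⟨k, by ring⟩]
  rw [e, h, ← mul_assoc, e2, neg_one_mul, neg_add_eq_zero]
  simp only [Multiset.map_map, Function.comp_def]
  rfl

theorem Multiset.psum_congr {R : Type*} [CommRing R] {s t : Multiset R} {d : ℕ}
    (h : ∀ j < d, s.esymm j = t.esymm j) :
    ∀ k, k ≠ 0 → k < d → (s.map (· ^ k)).sum = (t.map (· ^ k)).sum := by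
  intro k
  induction k using Nat.strong_induction_on with
  | _ k ih =>
    intro hk hkd
    obtain ⟨m, rfl⟩ := Nat.exists_eq_succ_of_ne_zero hk
    have h1 := Multiset.newton s (m + 1)
    have h2 := Multiset.newton t (m + 1)
    rw [Finset.sum_range_succ'] at h1 h2
    rw [h _ hkd, h 0 (by omega), Finset.sum_congr rfl fun j hj => by
      rw [h (j + 1) (by have := Finset.mem_range.mp hj; omega),
        ih (m + 1 - (j + 1)) (by omega) (by have := Finset.mem_range.mp hj; omega)
          (by omega)]] at h1
    simpa [Multiset.esymm_zero_right] using h1.trans h2.symm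

theorem Multiset.psum_sub_psum {R : Type*} [CommRing R] {s t : Multiset R} {d : ℕ} (hd : d ≠ 0)
    (h : ∀ j < d, s.esymm j = t.esymm j) :
    (s.map (· ^ d)).sum - (t.map (· ^ d)).sum =
      d * ((-1) ^ d * t.esymm d - (-1) ^ d * s.esymm d) := by
  obtain ⟨m, rfl⟩ := Nat.exists_eq_succ_of_ne_zero hd
  have h1 := Multiset.newton s (m + 1)
  have h2 := Multiset.newton t (m + 1)
  rw [Finset.sum_range_succ'] at h1 h2
  rw [h 0 (by omega), Finset.sum_congr rfl fun j hj => by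
    rw [h (j + 1) (by have := Finset.mem_range.mp hj; omega),
      Multiset.psum_congr h (m + 1 - (j + 1)) (by have := Finset.mem_range.mp hj; omega)
        (by omega)]] at h1
  simp only [Multiset.esymm_zero_right, pow_zero, mul_one, one_mul, Nat.sub_zero] at h1 h2
  simp only [Nat.succ_eq_add_one]
  linear_combination h1 - h2

end Newton

section Vanishing

open Polynomial

theorem Multiset.sum_map_aeval {k E : Type*} [CommRing k] [CommRing E] [Algebra k E] (G : k[X])
    (s : Multiset E) :
    (s.map fun α => aeval α G).sum =
      ∑ i ∈ Finset.range (G.natDegree + 1), G.coeff i • (s.map (· ^ i)).sum := by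
  induction s using Multiset.induction with
  | empty => simp
  | cons a s ih =>
    rw [Multiset.map_cons, Multiset.sum_cons, ih, aeval_eq_sum_range, ← Finset.sum_add_distrib]
    simp

theorem Polynomial.Monic.esymm_aroots {k : Type*} [Field k] {f : k[X]} (hf : f.Monic) {j : ℕ}
    (hj : j ≤ f.natDegree) :
    (-1) ^ j * (f.aroots (AlgebraicClosure k)).esymm j =
      algebraMap k _ (f.coeff (f.natDegree - j)) := by
  have h := coeff_eq_esymm_roots_of_splits
    (IsAlgClosed.splits (f.map (algebraMap k (AlgebraicClosure k))))
    (k := f.natDegree - j) (by simp)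
  rw [Polynomial.natDegree_map, Nat.sub_sub_self hj,
    (hf.map (algebraMap k (AlgebraicClosure k))).leadingCoeff, one_mul, coeff_map] at h
  rw [h, aroots_def]

theorem sum_aeval_aroots_add {k : Type*} [Field k] {f G : k[X]} (hf : f.Monic)
    (hG : G.natDegree ≠ 0) (hn : G.natDegree ≤ f.natDegree) (c : k) :
    (((f + C c * X ^ (f.natDegree - G.natDegree)).aroots (AlgebraicClosure k)).map
        fun α => aeval α G).sum =
      ((f.aroots (AlgebraicClosure k)).map fun α => aeval α G).sum -
        algebraMap k _ (G.leadingCoeff * (G.natDegree * c)) := by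
  set d := G.natDegree
  set n := f.natDegree
  set g := f + C c * X ^ (n - d)
  have hdeg : (C c * X ^ (n - d)).degree < f.degree := by
    refine (degree_C_mul_X_pow_le _ _).trans_lt ?_
    rw [degree_eq_natDegree hf.ne_zero]
    exact_mod_cast (by omega : n - d < n)
  have hg : g.Monic := hf.add_of_left hdeg
  have hgn : g.natDegree = n := natDegree_eq_of_degree_eq (degree_add_eq_left_of_degree_lt hdeg)
  have hcoeff : ∀ j ≤ d, (-1) ^ j * (g.aroots (AlgebraicClosure k)).esymm j =
      (-1) ^ j * (f.aroots (AlgebraicClosure k)).esymm j +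
        if j = d then algebraMap k _ c else 0 := by
    intro j hj
    rw [hg.esymm_aroots (by omega), hf.esymm_aroots (by omega), hgn, coeff_add, coeff_C_mul_X_pow,
      map_add]
    congr 1
    by_cases h : j = d
    · simp [h]
    · rw [if_neg h, if_neg (by omega), map_zero]
  have hlt : ∀ j < d, (g.aroots (AlgebraicClosure k)).esymm j =
      (f.aroots (AlgebraicClosure k)).esymm j := by
    intro j hj
    have h := hcoeff j hj.le
    rw [if_neg hj.ne, add_zero] at h
    exact mul_left_cancel₀ (pow_ne_zero _ (by simp)) h
  have hd := Multiset.psum_sub_psum hG hlt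
  have hcd := hcoeff d le_rfl
  rw [if_pos rfl] at hcd
  have hcard : (g.aroots (AlgebraicClosure k)).card = (f.aroots (AlgebraicClosure k)).card := by
    rw [aroots_def, aroots_def, ← (IsAlgClosed.splits _).natDegree_eq_card_roots,
      ← (IsAlgClosed.splits _).natDegree_eq_card_roots, natDegree_map, natDegree_map, hgn]
  rw [Multiset.sum_map_aeval, Multiset.sum_map_aeval, Finset.sum_range_succ,
    Finset.sum_range_succ]
  have hlow : ∀ i ∈ Finset.range d, G.coeff i • ((g.aroots (AlgebraicClosure k)).map (· ^ i)).sum =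
      G.coeff i • ((f.aroots (AlgebraicClosure k)).map (· ^ i)).sum := by
    intro i hi
    rcases eq_or_ne i 0 with rfl | h0
    · simp only [pow_zero, Multiset.map_const', Multiset.sum_replicate, hcard]
    · rw [Multiset.psum_congr hlt i h0 (Finset.mem_range.mp hi)]
  rw [Finset.sum_congr rfl hlow, eq_add_of_sub_eq hd, hcd, Algebra.smul_def, Algebra.smul_def,
    map_mul, map_mul, map_natCast, leadingCoeff]
  ring

variable {p : ℕ} [Fact p.Prime] {χ : MulChar (ZMod p) ℂ}
  {Ψ : AddChar (AlgebraicClosure (ZMod p)) ℂ} {G : (ZMod p)[X]}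

theorem lCoeff_eq_zero (hG0 : G.natDegree ≠ 0) (hGp : G.natDegree < p)
    {ψ : AddChar (ZMod p) ℂ} (hψ : ψ ≠ 1) (hΨ : ∀ x, Ψ (algebraMap _ _ x) = ψ x)
    {n : ℕ} (hn : G.natDegree < n) : lCoeff χ Ψ G n = 0 := by
  classical
  obtain ⟨y, hy⟩ := AddChar.ne_one_iff.mp hψ
  have hd : (G.natDegree : ZMod p) ≠ 0 := by
    rw [Ne, ZMod.natCast_eq_zero_iff]
    exact fun h => hG0 (Nat.eq_zero_of_dvd_of_lt h hGp)
  have hl : G.leadingCoeff ≠ 0 := by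
    rw [Ne, leadingCoeff_eq_zero]
    rintro rfl
    simp at hG0
  set c : ZMod p := -y / (G.leadingCoeff * G.natDegree)
  have hc : -(G.leadingCoeff * (G.natDegree * c)) = y := by
    simp only [c]
    field_simp
  have hdeg : ∀ c' : ZMod p, ∀ f ∈ monicsOfDegree (ZMod p) n,
      f + C c' * X ^ (n - G.natDegree) ∈ monicsOfDegree (ZMod p) n := by
    intro c' f hf
    obtain ⟨hf1, hf2⟩ := mem_monicsOfDegree.mp hf
    have hdeg : (C c' * X ^ (n - G.natDegree)).degree < f.degree := by
      refine (degree_C_mul_X_pow_le _ _).trans_lt ?_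
      rw [degree_eq_natDegree hf1.ne_zero, hf2]
      exact_mod_cast (by omega : n - G.natDegree < n)
    exact mem_monicsOfDegree.mpr ⟨hf1.add_of_left hdeg,
      (natDegree_eq_of_degree_eq (degree_add_eq_left_of_degree_lt hdeg)).trans hf2⟩
  have hw : ∀ f ∈ monicsOfDegree (ZMod p) n,
      polyWeight χ Ψ G (f + C c * X ^ (n - G.natDegree)) = ψ y * polyWeight χ Ψ G f := by
    intro f hf
    obtain ⟨hf1, hf2⟩ := mem_monicsOfDegree.mp hf
    obtain ⟨-, hf3⟩ := mem_monicsOfDegree.mp (hdeg c f hf)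
    have h0 : (f + C c * X ^ (n - G.natDegree)).coeff 0 = f.coeff 0 := by
      rw [coeff_add, coeff_C_mul_X_pow, if_neg (by omega), add_zero]
    have hs := sum_aeval_aroots_add hf1 hG0 (by omega) c
    rw [hf2] at hs
    rw [polyWeight, polyWeight, h0, hf3, hf2, hs, sub_eq_add_neg, ← map_neg, hc,
      AddChar.map_add_eq_mul, hΨ]
    ring
  have hsum : lCoeff χ Ψ G n = ψ y * lCoeff χ Ψ G n := by
    conv_rhs => rw [lCoeff, Finset.mul_sum, ← Finset.sum_congr rfl hw]
    refine (Finset.sum_nbij' (fun f => f + C c * X ^ (n - G.natDegree))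
      (fun f => f + C (-c) * X ^ (n - G.natDegree)) (hdeg c) (hdeg (-c)) ?_ ?_ ?_).symm
    all_goals
      intro f _
      simp
  have : (ψ y - 1) * lCoeff χ Ψ G n = 0 := by
    rw [sub_mul, one_mul, ← hsum, sub_self]
  exact (mul_eq_zero.mp this).resolve_left (sub_ne_zero.mpr hy)

end Vanishing

section PowerSums

open Polynomial

theorem Multiset.exists_esymm_eq {E : Type*} [Field E] [IsAlgClosed E] {b : ℕ → E} {d : ℕ}
    (h0 : b 0 = 1) (hd : ∀ n, d < n → b n = 0) :
    ∃ s : Multiset E, s.card = d ∧ ∀ j, (-1) ^ j * s.esymm j = b j := by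
  set R : E[X] := ∑ i ∈ Finset.range d, C (b (d - i)) * X ^ i
  have hR : ∀ m, R.coeff m = if m < d then b (d - m) else 0 := by
    intro m
    simp only [R, finsetSum_coeff, coeff_C_mul_X_pow]
    rw [Finset.sum_ite_eq]
    simp
  have hRd : R.degree < d := (degree_lt_iff_coeff_zero _ _).mpr fun m hm => by
    rw [hR, if_neg (by omega)]
  have hm : (X ^ d + R).Monic := monic_X_pow_add hRd
  have hdeg : (X ^ d + R).natDegree = d := by
    refine natDegree_eq_of_degree_eq_some ?_
    rw [degree_add_eq_left_of_degree_lt (by rwa [degree_X_pow]), degree_X_pow]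
  have hcard : (X ^ d + R).roots.card = d := by
    rw [← (IsAlgClosed.splits (X ^ d + R)).natDegree_eq_card_roots, hdeg]
  refine ⟨(X ^ d + R).roots, hcard, fun j => ?_⟩
  rcases Nat.lt_or_ge d j with hj | hj
  · rw [hd j hj, Multiset.esymm, Multiset.powersetCard_eq_empty _ (by omega)]
    simp
  · have h := coeff_eq_esymm_roots_of_splits (IsAlgClosed.splits (X ^ d + R)) (k := d - j)
      (by omega)
    rw [hm.leadingCoeff, one_mul, hdeg, Nat.sub_sub_self hj] at h
    rw [← h, coeff_add, coeff_X_pow, hR]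
    rcases eq_or_ne j 0 with rfl | hj0
    · simp [h0]
    · rw [if_neg (by omega), if_pos (by omega), zero_add, Nat.sub_sub_self hj]

theorem Multiset.eq_neg_psum_of_newton {R : Type*} [CommRing R] {s : Multiset R} {b S : ℕ → R}
    (hb : ∀ j, (-1) ^ j * s.esymm j = b j)
    (hS : ∀ n : ℕ, n * b n = ∑ j ∈ Finset.Icc 1 n, S j * b (n - j)) :
    ∀ n, n ≠ 0 → S n = -(s.map (· ^ n)).sum := by
  intro n
  induction n using Nat.strong_induction_on with
  | _ n ih =>
    intro hn
    obtain ⟨m, rfl⟩ := Nat.exists_eq_succ_of_ne_zero hn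
    have hb0 : b 0 = 1 := by rw [← hb 0, Multiset.esymm_zero_right]; simp
    have h1 := Multiset.newton s (m + 1)
    have h2 := hS (m + 1)
    simp only [hb] at h1
    rw [Finset.sum_range_succ', hb0, one_mul, Nat.sub_zero] at h1
    rw [Finset.sum_Icc_succ_top (by omega), Nat.sub_self, hb0, mul_one] at h2
    have h3 : ∑ j ∈ Finset.range m, b (j + 1) * (s.map (· ^ (m + 1 - (j + 1)))).sum =
        -∑ j ∈ Finset.Icc 1 m, S j * b (m + 1 - j) := by
      rw [← Finset.sum_neg_distrib]
      refine Finset.sum_nbij' (fun j => m - j) (fun j => m - j) ?_ ?_ ?_ ?_ ?_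
      · intro j hj
        have := Finset.mem_range.mp hj
        exact Finset.mem_Icc.mpr (by omega)
      · intro j hj
        have := Finset.mem_Icc.mp hj
        exact Finset.mem_range.mpr (by omega)
      · intro j hj
        have := Finset.mem_range.mp hj
        change m - (m - j) = j
        omega
      · intro j hj
        have := Finset.mem_Icc.mp hj
        change m - (m - j) = j
        omega
      · intro j hj
        have := Finset.mem_range.mp hj
        change _ = -(S (m - j) * b (m + 1 - (m - j)))
        rw [ih (m - j) (by omega) (by omega), Nat.add_sub_add_right,
          show m + 1 - (m - j) = j + 1 by omega]
        ring
    rw [h3] at h1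
    simp only [Nat.succ_eq_add_one]
    linear_combination h1 - h2

theorem Multiset.norm_le_of_norm_psum_le {s : Multiset ℂ} {A ρ : ℝ} (hρ : 0 < ρ) {N : ℕ}
    (h : ∀ k, N ≤ k → ‖(s.map (· ^ k)).sum‖ ≤ A * ρ ^ k) {β : ℂ} (hβ : β ∈ s) : ‖β‖ ≤ ρ := by
  classical
  by_contra! hlt
  set Q : ℂ[X] := ∏ γ ∈ s.toFinset.erase β, (X - C γ)
  have hQβ : Q.eval β ≠ 0 := by
    rw [eval_prod, Finset.prod_ne_zero_iff]
    intro γ hγ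
    simpa using sub_ne_zero.mpr (Finset.ne_of_mem_erase hγ).symm
  have hQ : ∀ γ ∈ s.toFinset, γ ≠ β → Q.eval γ = 0 := by
    intro γ hγ hne
    rw [eval_prod]
    exact Finset.prod_eq_zero (Finset.mem_erase.mpr ⟨hne, hγ⟩) (by simp)
  have hcomb : ∀ k, ∑ i ∈ Finset.range (Q.natDegree + 1),
      Q.coeff i * (s.map (· ^ (k + i))).sum = s.count β * (β ^ k * Q.eval β) := by
    intro k
    have h1 : ∑ i ∈ Finset.range (Q.natDegree + 1), Q.coeff i * (s.map (· ^ (k + i))).sum =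
        (s.map fun γ => γ ^ k * Q.eval γ).sum := by
      generalize s = t
      induction t using Multiset.induction with
      | empty => simp
      | cons a t ih =>
        simp only [Multiset.map_cons, Multiset.sum_cons, mul_add, Finset.sum_add_distrib] at ih ⊢
        rw [ih, eval_eq_sum_range, Finset.mul_sum]
        congr 1
        refine Finset.sum_congr rfl fun i _ => ?_
        ring
    rw [h1, Finset.sum_multiset_map_count, Finset.sum_eq_single β, nsmul_eq_mul]
    · intro γ hγ hne
      rw [hQ γ hγ hne]
      simp
    · intro hn
      exact absurd (Multiset.mem_toFinset.mpr hβ) hn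
  set B : ℝ := ∑ i ∈ Finset.range (Q.natDegree + 1), ‖Q.coeff i‖ * (A * ρ ^ i)
  have hc : 0 < ‖Q.eval β‖ := norm_pos_iff.mpr hQβ
  have hbound : ∀ k, N ≤ k → ‖Q.eval β‖ * (‖β‖ / ρ) ^ k ≤ B := by
    intro k hk
    have h2 : ‖(s.count β : ℂ) * (β ^ k * Q.eval β)‖ ≤ B * ρ ^ k := by
      rw [← hcomb, Finset.sum_mul]
      refine norm_sum_le_of_le _ fun i _ => ?_
      rw [norm_mul]
      calc ‖Q.coeff i‖ * ‖(s.map (· ^ (k + i))).sum‖ ≤ ‖Q.coeff i‖ * (A * ρ ^ (k + i)) := by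
            gcongr
            exact h _ (by omega)
        _ = ‖Q.coeff i‖ * (A * ρ ^ i) * ρ ^ k := by ring
    have h3 : (1 : ℝ) ≤ s.count β := by exact_mod_cast Multiset.one_le_count_iff_mem.mpr hβ
    rw [norm_mul, norm_mul, norm_pow, Complex.norm_natCast] at h2
    rw [div_pow, ← mul_div_assoc, div_le_iff₀ (by positivity)]
    refine le_trans ?_ h2
    rw [mul_comm (‖Q.eval β‖)]
    exact le_mul_of_one_le_left (by positivity) h3
  have ht := tendsto_pow_atTop_atTop_of_one_lt ((one_lt_div hρ).mpr hlt)
  obtain ⟨k, hk1, hk2⟩ := ((ht.eventually_gt_atTop (B / ‖Q.eval β‖)).and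
    (Filter.eventually_ge_atTop N)).exists
  have := hbound k hk2
  rw [div_lt_iff₀' hc] at hk1
  linarith

end PowerSums

section CompleteSum

open Polynomial

variable {p : ℕ} [Fact p.Prime]

theorem AddChar.exists_extension {k E R : Type*} [Field k] [Field E] [Algebra k E] [CommMonoid R]
    (ψ : AddChar k R) : ∃ Ψ : AddChar E R, ∀ x, Ψ (algebraMap k E x) = ψ x := by
  obtain ⟨π, hπ⟩ := LinearMap.exists_leftInverse_of_injective (Algebra.linearMap k E)
    (LinearMap.ker_eq_bot.mpr (algebraMap k E).injective)
  refine ⟨ψ.compAddMonoidHom π.toAddMonoidHom, fun x => ?_⟩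
  have := LinearMap.congr_fun hπ x
  simp only [LinearMap.comp_apply, Algebra.linearMap_apply, LinearMap.id_apply] at this
  simp [this]

theorem sum_galoisField_one {χ : MulChar (ZMod p) ℂ} {ψ : AddChar (ZMod p) ℂ} (G : (ZMod p)[X]) :
    ∑ x : GaloisField p 1,
        χ (Algebra.norm (ZMod p) x) * ψ (Algebra.trace (ZMod p) _ (aeval x G)) =
      ∑ x : ZMod p, χ x * ψ (G.eval x) := by
  have h1 := GaloisField.finrank p one_ne_zero
  refine (Fintype.sum_equiv (GaloisField.equivZmodP p).symm.toEquiv _ _ fun x => ?_).symm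
  have hx : (GaloisField.equivZmodP p).symm x = algebraMap (ZMod p) (GaloisField p 1) x :=
    (GaloisField.equivZmodP p).symm.commutes x
  change _ = χ (Algebra.norm (ZMod p) ((GaloisField.equivZmodP p).symm x)) *
    ψ (Algebra.trace (ZMod p) _ (aeval ((GaloisField.equivZmodP p).symm x) G))
  rw [hx, Algebra.norm_algebraMap, aeval_algebraMap_apply, Algebra.trace_algebraMap, h1, pow_one,
    one_smul, coe_aeval_eq_eval]

/-- Weil's bound for complete mixed character sums over a prime field. -/
theorem norm_sum_mulChar_mul_addChar_le (χ : DirichletCharacter ℂ p) {ψ : AddChar (ZMod p) ℂ}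
    (hψ : ψ ≠ 1) {G : (ZMod p)[X]} (hG0 : G.natDegree ≠ 0) (hGp : G.natDegree < p) :
    ‖∑ x : ZMod p, χ x * ψ (G.eval x)‖ ≤ G.natDegree * √p := by
  have hp : p.Prime := Fact.out
  obtain ⟨Ψ, hΨ⟩ := ψ.exists_extension (E := AlgebraicClosure (ZMod p))
  set S : ℕ → ℂ := fun j => ∑ x : GaloisField p j,
    χ (Algebra.norm (ZMod p) x) * ψ (Algebra.trace (ZMod p) _ (aeval x G))
  have hS : ∀ n : ℕ, n * lCoeff χ Ψ G n =
      ∑ j ∈ Finset.Icc 1 n, S j * lCoeff χ Ψ G (n - j) := by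
    intro n
    rw [mul_lCoeff]
    simp only [polyWeight_conjPoly, hΨ]
    rfl
  obtain ⟨s, hcard, hs⟩ := Multiset.exists_esymm_eq (b := lCoeff χ Ψ G) lCoeff_zero
    fun n hn => lCoeff_eq_zero hG0 hGp hψ hΨ hn
  have hpsum := Multiset.eq_neg_psum_of_newton hs hS
  obtain ⟨g, hg⟩ : ∃ g, g = (p - 1) * (G.natDegree * (p - 1)) := ⟨_, rfl⟩
  have hbound : ∀ a, g ^ 2 + 3 * g + 1 ≤ a →
      ‖((s.map (· ^ 2)).map (· ^ a)).sum‖ ≤ (2 * g + 2) * (p : ℝ) ^ a := by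
    intro a ha
    have h := norm_sum_norm_trace_le (K := GaloisField p (2 * a)) hG0 hGp (a := a) ?_ hg
      (ha.trans_lt (Nat.lt_pow_self hp.one_lt)) χ hψ
    · have h2 : ‖S (2 * a)‖ ≤ (2 * g + 2) * (p : ℝ) ^ a := h
      rw [hpsum _ (by omega), norm_neg] at h2
      simpa [Multiset.map_map, ← pow_mul] using h2
    · rw [Fintype.card_eq_nat_card, GaloisField.card p _ (by omega), mul_comm, pow_mul]
  have hroot : ∀ ω ∈ s, ‖ω‖ ≤ √p := by
    intro ω hω
    have h := Multiset.norm_le_of_norm_psum_le (by exact_mod_cast hp.pos) hbound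
      (Multiset.mem_map_of_mem (· ^ 2) hω)
    rw [norm_pow] at h
    exact Real.le_sqrt_of_sq_le h
  have h1 : ∑ x : ZMod p, χ x * ψ (G.eval x) = -s.sum := by
    rw [← sum_galoisField_one]
    simpa using hpsum 1 one_ne_zero
  rw [h1, norm_neg, ← hcard, ← nsmul_eq_mul]
  refine (Multiset.le_sum_of_subadditive _ norm_zero.le norm_add_le s).trans ?_
  have := Multiset.sum_le_card_nsmul (s.map norm) (√p) (by simpa using hroot)
  simpa using this

end CompleteSum

section Completion

theorem one_div_sin_le {N t : ℕ} (ht0 : 0 < t) (htN : t < N) :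
    1 / Real.sin (Real.pi * t / N) ≤ N / 2 * (1 / t + 1 / ((N - t : ℕ) : ℝ)) := by
  have hπ := Real.pi_pos
  have ht : (0 : ℝ) < t := by exact_mod_cast ht0
  have hs : (0 : ℝ) < ((N - t : ℕ) : ℝ) := by exact_mod_cast Nat.sub_pos_of_lt htN
  have hN : (0 : ℝ) < N := by exact_mod_cast ht0.trans htN
  have hst : ((N - t : ℕ) : ℝ) = N - t := Nat.cast_sub htN.le
  have key : ∀ s : ℝ, 0 < s → 2 * s ≤ N → 1 / Real.sin (Real.pi * s / N) ≤ N / 2 * (1 / s) := by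
    intro s hs hsN
    have h := Real.mul_le_sin (x := Real.pi * s / N) (by positivity) (by
      rw [div_le_div_iff₀ hN two_pos]
      nlinarith)
    have e : 2 / Real.pi * (Real.pi * s / N) = 2 * s / N := by field_simp
    rw [e] at h
    calc 1 / Real.sin (Real.pi * s / N) ≤ 1 / (2 * s / N) := by gcongr
      _ = N / 2 * (1 / s) := by field_simp
  rcases le_total (2 * (t : ℝ)) N with h | h
  · refine (key t ht h).trans ?_
    gcongr
    exact le_add_of_nonneg_right (by positivity)
  · have e : Real.sin (Real.pi * t / N) = Real.sin (Real.pi * ((N - t : ℕ) : ℝ) / N) := by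
      rw [← Real.sin_pi_sub, hst]
      congr 1
      field_simp
    rw [e]
    refine (key _ hs (by rw [hst]; linarith)).trans ?_
    gcongr
    exact le_add_of_nonneg_left (by positivity)

variable {N : ℕ} [NeZero N]

theorem norm_sum_Icc_stdAddChar_le (a : ZMod N) (ha : a ≠ 0) (u h : ℤ) (hh : 0 ≤ h) :
    ‖∑ x ∈ Finset.Icc (u + 1) (u + h), (ZMod.stdAddChar (a * (x : ZMod N)) : ℂ)‖ ≤
      1 / Real.sin (Real.pi * a.val / N) := by
  have hN : (0 : ℝ) < N := by exact_mod_cast NeZero.pos N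
  have ht0 : 0 < a.val := Nat.pos_of_ne_zero ((ZMod.val_ne_zero a).mpr ha)
  have hsin : 0 < Real.sin (Real.pi * a.val / N) := by
    refine Real.sin_pos_of_pos_of_lt_pi (by positivity) ?_
    rw [div_lt_iff₀ hN]
    exact mul_lt_mul_of_pos_left (by exact_mod_cast ZMod.val_lt a) Real.pi_pos
  set z : ℂ := ZMod.stdAddChar a
  have hz : ‖z - 1‖ = 2 * Real.sin (Real.pi * a.val / N) := by
    have e : z = Complex.exp (Complex.I * ((2 * Real.pi * a.val / N : ℝ) : ℂ)) := by
      simp only [z]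
      rw [ZMod.stdAddChar_apply, ZMod.toCircle_apply]
      congr 1
      push_cast
      ring
    rw [e, Complex.norm_exp_I_mul_ofReal_sub_one, Real.norm_of_nonneg]
    · congr 2
      ring
    · rw [show 2 * Real.pi * a.val / N / 2 = Real.pi * a.val / N by ring]
      positivity
  have hz1 : z ≠ 1 := by
    intro h
    rw [h, sub_self, norm_zero] at hz
    linarith
  obtain ⟨m, rfl⟩ := Int.eq_ofNat_of_zero_le hh
  have hsum : ∑ x ∈ Finset.Icc (u + 1) (u + m), (ZMod.stdAddChar (a * (x : ZMod N)) : ℂ) =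
      ZMod.stdAddChar (a * ((u + 1 : ℤ) : ZMod N)) * ∑ i ∈ Finset.range m, z ^ i := by
    rw [Finset.mul_sum]
    refine Finset.sum_bij' (fun x _ => (x - (u + 1)).toNat) (fun i _ => u + 1 + i) ?_ ?_ ?_ ?_ ?_
    · intro x hx
      have := Finset.mem_Icc.mp hx
      exact Finset.mem_range.mpr (by omega)
    · intro i hi
      have := Finset.mem_range.mp hi
      exact Finset.mem_Icc.mpr (by omega)
    · intro x hx
      have := Finset.mem_Icc.mp hx
      omega
    · intro i hi
      omega
    · intro x hx
      have := Finset.mem_Icc.mp hx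
      rw [← AddChar.map_nsmul_eq_pow, ← AddChar.map_add_eq_mul]
      congr 1
      obtain ⟨i, hi⟩ := Int.eq_ofNat_of_zero_le (show 0 ≤ x - (u + 1) by omega)
      obtain rfl : x = u + 1 + i := by omega
      simp
      ring
  rw [hsum, norm_mul, AddChar.norm_apply, one_mul, geom_sum_eq hz1, norm_div, hz,
    div_le_div_iff₀ (by positivity) hsin, one_mul]
  gcongr
  refine (norm_sub_le _ _).trans ?_
  rw [norm_pow, AddChar.norm_apply]
  norm_num

theorem sum_norm_sum_Icc_stdAddChar_le (u h : ℤ) (hh : 0 ≤ h) (hN : h ≤ N) :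
    ∑ a : ZMod N, ‖∑ x ∈ Finset.Icc (u + 1) (u + h), (ZMod.stdAddChar (a * (x : ZMod N)) : ℂ)‖ ≤
      N * (2 + Real.log N) := by
  have hsum : ∀ F : ZMod N → ℝ, ∑ a, F a = F 0 + ∑ t ∈ Finset.Icc 1 (N - 1), F t := by
    intro F
    have h1 : ∑ a, F a = ∑ t ∈ Finset.range N, F t :=
      Finset.sum_nbij' ZMod.val Nat.cast (fun a _ => Finset.mem_range.mpr (ZMod.val_lt a))
        (fun _ _ => Finset.mem_univ _) (fun a _ => ZMod.natCast_zmod_val a)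
        (fun t ht => ZMod.val_cast_of_lt (Finset.mem_range.mp ht))
        (fun a _ => by rw [ZMod.natCast_zmod_val])
    have h2 : Finset.range N = insert 0 (Finset.Icc 1 (N - 1)) := by
      have := NeZero.pos N
      ext t
      simp only [Finset.mem_range, Finset.mem_insert, Finset.mem_Icc]
      omega
    rw [h1, h2, Finset.sum_insert (by simp), Nat.cast_zero]
  rw [hsum]
  have h0 : ‖∑ x ∈ Finset.Icc (u + 1) (u + h),
      (ZMod.stdAddChar ((0 : ZMod N) * (x : ZMod N)) : ℂ)‖ ≤ N := by
    simp only [zero_mul, AddChar.map_zero_eq_one, Finset.sum_const, nsmul_eq_mul, mul_one,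
      Complex.norm_natCast, Int.card_Icc]
    exact_mod_cast (by omega : (u + h + 1 - (u + 1)).toNat ≤ N)
  have h1 : ∀ t ∈ Finset.Icc 1 (N - 1), ‖∑ x ∈ Finset.Icc (u + 1) (u + h),
      (ZMod.stdAddChar ((t : ZMod N) * (x : ZMod N)) : ℂ)‖ ≤
        N / 2 * (1 / t + 1 / ((N - t : ℕ) : ℝ)) := by
    intro t ht
    have ht' := Finset.mem_Icc.mp ht
    have hval : (t : ZMod N).val = t := ZMod.val_cast_of_lt (by omega)
    have hne : (t : ZMod N) ≠ 0 := by
      rw [← ZMod.val_ne_zero, hval]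
      omega
    refine (norm_sum_Icc_stdAddChar_le _ hne u h hh).trans ?_
    rw [hval]
    exact one_div_sin_le (by omega) (by omega)
  have hharm : ∑ t ∈ Finset.Icc 1 (N - 1), (1 / t : ℝ) ≤ 1 + Real.log N := by
    have h := harmonic_le_one_add_log (N - 1)
    rw [harmonic_eq_sum_Icc] at h
    push_cast at h
    simp only [one_div]
    refine h.trans ?_
    have : Real.log ((N - 1 : ℕ) : ℝ) ≤ Real.log N := by
      rcases Nat.eq_zero_or_pos (N - 1) with h0 | h0
      · rw [h0, Nat.cast_zero, Real.log_zero]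
        exact Real.log_natCast_nonneg N
      · exact Real.log_le_log (by exact_mod_cast h0) (by exact_mod_cast Nat.sub_le N 1)
    linarith
  have hrefl : ∑ t ∈ Finset.Icc 1 (N - 1), (1 / ((N - t : ℕ) : ℝ)) =
      ∑ t ∈ Finset.Icc 1 (N - 1), (1 / t : ℝ) :=
    Finset.sum_bij' (fun t _ => N - t) (fun t _ => N - t)
      (fun t ht => by have := Finset.mem_Icc.mp ht; exact Finset.mem_Icc.mpr (by omega))
      (fun t ht => by have := Finset.mem_Icc.mp ht; exact Finset.mem_Icc.mpr (by omega))
      (fun t ht => by have := Finset.mem_Icc.mp ht; omega)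
      (fun t ht => by have := Finset.mem_Icc.mp ht; omega) (fun _ _ => rfl)
  calc _ ≤ (N : ℝ) + ∑ t ∈ Finset.Icc 1 (N - 1), N / 2 * (1 / t + 1 / ((N - t : ℕ) : ℝ)) :=
        add_le_add h0 (Finset.sum_le_sum h1)
    _ = N + N * ∑ t ∈ Finset.Icc 1 (N - 1), (1 / t : ℝ) := by
        rw [← Finset.mul_sum, Finset.sum_add_distrib, hrefl]
        ring
    _ ≤ N + N * (1 + Real.log N) := by gcongr
    _ = N * (2 + Real.log N) := by ring

/-- The completion method (Pólya–Vinogradov) for incomplete sums over an interval. -/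
theorem norm_sum_Icc_le_of_forall_norm_sum_le {f : ZMod N → ℂ} {B : ℝ}
    (hf : ∀ a : ZMod N, ‖∑ y, f y * ZMod.stdAddChar (a * y)‖ ≤ B) {u h : ℤ} (hh : 0 ≤ h)
    (hN : h ≤ N) : ‖∑ x ∈ Finset.Icc (u + 1) (u + h), f x‖ ≤ B * (2 + Real.log N) := by
  classical
  have hN0 : (0 : ℝ) < N := by exact_mod_cast NeZero.pos N
  have hB : 0 ≤ B := (norm_nonneg _).trans (hf 0)
  have horth : ∀ x y : ZMod N, ∑ a : ZMod N, (ZMod.stdAddChar (-a * y) : ℂ) *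
      ZMod.stdAddChar (a * x) = if y = x then (N : ℂ) else 0 := by
    intro x y
    have h := AddChar.sum_mulShift (x - y) (ZMod.isPrimitive_stdAddChar N)
    rw [ZMod.card] at h
    simp_rw [← AddChar.map_add_eq_mul]
    rw [Finset.sum_congr rfl fun a _ => by rw [show -a * y + a * x = a * (x - y) by ring], h]
    simp only [sub_eq_zero, eq_comm (a := x)]
    split_ifs <;> simp
  have hexp : (N : ℂ) * ∑ x ∈ Finset.Icc (u + 1) (u + h), f x =
      ∑ a : ZMod N, (∑ y, f y * ZMod.stdAddChar (-a * y)) *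
        ∑ x ∈ Finset.Icc (u + 1) (u + h), ZMod.stdAddChar (a * (x : ZMod N)) := by
    simp_rw [Finset.mul_sum, Finset.sum_mul]
    rw [Finset.sum_comm]
    refine Finset.sum_congr rfl fun x _ => ?_
    rw [Finset.sum_comm]
    simp_rw [mul_assoc, ← Finset.mul_sum, horth]
    simp [mul_comm]
  have hmul : (N : ℝ) * ‖∑ x ∈ Finset.Icc (u + 1) (u + h), f x‖ ≤ N * (B * (2 + Real.log N)) := by
    calc (N : ℝ) * ‖∑ x ∈ Finset.Icc (u + 1) (u + h), f x‖
        = ‖(N : ℂ) * ∑ x ∈ Finset.Icc (u + 1) (u + h), f x‖ := by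
          rw [norm_mul, Complex.norm_natCast]
      _ ≤ ∑ a : ZMod N, B * ‖∑ x ∈ Finset.Icc (u + 1) (u + h),
            (ZMod.stdAddChar (a * (x : ZMod N)) : ℂ)‖ := by
          rw [hexp]
          refine norm_sum_le_of_le _ fun a _ => ?_
          rw [norm_mul]
          gcongr
          exact hf (-a)
      _ ≤ B * (N * (2 + Real.log N)) := by
          rw [← Finset.mul_sum]
          gcongr
          exact sum_norm_sum_Icc_stdAddChar_le u h hh hN
      _ = N * (B * (2 + Real.log N)) := by ring
  exact le_of_mul_le_mul_left hmul hN0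

end Completion

section MixedSums

open Polynomial

variable {p : ℕ} [Fact p.Prime]

theorem norm_sum_mulChar_mul_stdAddChar_le (χ : DirichletCharacter ℂ p) {lam : ZMod p}
    {F : (ZMod p)[X]} (hF : 2 ≤ F.natDegree) (hFp : F.natDegree < p)
    (hχ : ¬(χ = 1 ∧ lam = 0)) (a : ZMod p) :
    ‖∑ y : ZMod p, χ y * ZMod.stdAddChar (lam * F.eval y) * ZMod.stdAddChar (a * y)‖ ≤
      F.natDegree * √p := by
  have hψ : (ZMod.stdAddChar : AddChar (ZMod p) ℂ) ≠ 1 := by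
    simpa using ZMod.isPrimitive_stdAddChar p one_ne_zero
  have hX : (C a * X : (ZMod p)[X]).natDegree ≤ 1 :=
    (natDegree_C_mul_le _ _).trans natDegree_X_le
  have hsum : ∑ y : ZMod p, χ y * ZMod.stdAddChar (lam * F.eval y) * ZMod.stdAddChar (a * y) =
      ∑ y, χ y * ZMod.stdAddChar ((C lam * F + C a * X).eval y) := by
    refine Finset.sum_congr rfl fun y _ => ?_
    rw [mul_assoc, ← AddChar.map_add_eq_mul]
    simp
  rw [hsum]
  by_cases hl : lam = 0
  · have hχ1 : χ ≠ 1 := fun h => hχ ⟨h, hl⟩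
    rw [hl, C_0, zero_mul, zero_add]
    rcases eq_or_ne a 0 with rfl | ha
    · simp only [C_0, zero_mul, eval_zero, AddChar.map_zero_eq_one, mul_one]
      rw [MulChar.sum_eq_zero_of_ne_one hχ1, norm_zero]
      positivity
    · have hd : (C a * X : (ZMod p)[X]).natDegree = 1 := natDegree_C_mul_X a ha
      refine (norm_sum_mulChar_mul_addChar_le χ hψ (by omega) (by omega)).trans ?_
      gcongr
      omega
  · have hd : (C lam * F + C a * X).natDegree = F.natDegree := by
      rw [natDegree_add_eq_left_of_natDegree_lt, natDegree_C_mul hl]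
      rw [natDegree_C_mul hl]
      omega
    refine (norm_sum_mulChar_mul_addChar_le χ hψ (by omega) (by omega)).trans ?_
    rw [hd]

end MixedSums

open Finset Complex

/-- Weil bound for incomplete mixed character sums: for a prime `p`, a Dirichlet
character `χ` mod `p`, `λ ∈ 𝔽_p` and a polynomial `F` over `𝔽_p` of degree `d ≥ 2`,
if `(χ, λ) ≠ (χ₀, 0)` then `|∑_{x=u+1}^{u+h} χ(x) e(λF(x)/p)| ≪_d p^{1/2} log p`. -/
theorem weil_incomplete_mixed_sum (d : ℕ) (hd : 2 ≤ d) :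
    ∃ C : ℝ, ∀ p : ℕ, p.Prime → ∀ χ : DirichletCharacter ℂ p, ∀ lam : ZMod p,
      ∀ F : Polynomial (ZMod p), F.natDegree = d →
      ¬(χ = 1 ∧ lam = 0) →
      ∀ u h : ℤ, 1 ≤ h → h ≤ p →
        ‖∑ x ∈ Finset.Icc (u + 1) (u + h),
            χ ((x : ℤ) : ZMod p) *
              Complex.exp (2 * Real.pi * Complex.I *
                (((lam * F.eval ((x : ℤ) : ZMod p)).val : ℕ) : ℂ) / (p : ℂ))‖
          ≤ C * Real.sqrt p * Real.log p := by
  refine ⟨4 * d, fun p hp χ lam F hF hχ u h h1 hhp => ?_⟩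
  have : Fact p.Prime := ⟨hp⟩
  subst hF
  have hexp : ∀ x : ZMod p,
      Complex.exp (2 * Real.pi * Complex.I * (((lam * F.eval x).val : ℕ) : ℂ) / (p : ℂ)) =
        ZMod.stdAddChar (lam * F.eval x) := fun x => by
    rw [ZMod.stdAddChar_apply, ZMod.toCircle_apply]
  simp only [hexp]
  have hp2 : (2 : ℝ) ≤ p := by exact_mod_cast hp.two_le
  have hlog : 0.69 < Real.log p :=
    (by linarith [Real.log_two_gt_d9] : 0.69 < Real.log 2).trans_le
      (Real.log_le_log two_pos hp2)
  rcases Nat.lt_or_ge F.natDegree p with hdp | hdp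
  · refine (norm_sum_Icc_le_of_forall_norm_sum_le (B := F.natDegree * √p)
      (f := fun y => χ y * ZMod.stdAddChar (lam * F.eval y))
      (norm_sum_mulChar_mul_stdAddChar_le χ hd hdp hχ) (by omega) hhp).trans ?_
    have hB : 0 ≤ F.natDegree * √(p : ℝ) := by positivity
    nlinarith
  · have hsqrt : 1 ≤ √(p : ℝ) := Real.one_le_sqrt.mpr (by linarith)
    have hcard : ((Finset.Icc (u + 1) (u + h)).card : ℝ) ≤ F.natDegree := by
      rw [Int.card_Icc]
      exact_mod_cast (by omega : (u + h + 1 - (u + 1)).toNat ≤ F.natDegree)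
    calc _ ≤ ∑ _x ∈ Finset.Icc (u + 1) (u + h), (1 : ℝ) := by
          refine norm_sum_le_of_le _ fun x _ => ?_
          rw [norm_mul, AddChar.norm_apply, mul_one]
          exact χ.norm_le_one _
      _ ≤ F.natDegree * 1 := by simpa using hcard
      _ ≤ F.natDegree * (4 * √p * Real.log p) := by
          gcongr
          nlinarith
      _ = 4 * F.natDegree * √p * Real.log p := by ring
end
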